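/- arXiv:1606.02135 — 9 statements merged into one kernel-verified Lean document; each statement's English description precedes it below -/
import Mathlib

section
/- Let K be an algebraically closed field of characteristic 2 and λ ∈ K with λ ≠ 0. Let X_λ ⊂ ℙ³ be the quartic surface defined by λ·x₀x₁²x₂ + x₁⁴ + x₁x₂³ + x₀³x₃ + x₀x₂x₃² = 0. Then the set of lines lying on X_λ is finite and has exactly 68 elements. -/
open MvPolynomial

/-- The Rams–Schütt quartic `λ·x₀x₁²x₂ + x₁⁴ + x₁x₂³ + x₀³x₃ + x₀x₂x₃²`. -/
noncomputable def ramsSchuett (K : Type*) [Field K] (lam : K) : MvPolynomial (Fin 4) K :=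
  C lam * (X 0 * X 1 ^ 2 * X 2) + X 1 ^ 4 + X 1 * X 2 ^ 3 + X 0 ^ 3 * X 3
    + X 0 * X 2 * X 3 ^ 2

section RamsSchuettLines

variable {K : Type*} [Field K]

theorem eval_ramsSchuett (lam : K) (v : Fin 4 → K) :
    eval v (ramsSchuett K lam) = lam * (v 0 * v 1 ^ 2 * v 2) + v 1 ^ 4 + v 1 * v 2 ^ 3
      + v 0 ^ 3 * v 3 + v 0 * v 2 * v 3 ^ 2 := by
  simp [ramsSchuett]

theorem exists_ne_zero_apply_eq_zero_of_finrank_eq_two {V : Type*} [AddCommGroup V] [Module K V]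
    {W : Submodule K V} (hW : Module.finrank K W = 2) (f : V →ₗ[K] K) :
    ∃ w ∈ W, w ≠ 0 ∧ f w = 0 := by
  have : FiniteDimensional K W := Module.finite_of_finrank_eq_succ hW
  obtain ⟨w, hw, hw0⟩ := (Submodule.ne_bot_iff _).1
    ((f.domRestrict W).ker_ne_bot_of_finrank_lt (by simp [hW]))
  exact ⟨w, w.2, by simpa using hw0, by simpa using hw⟩

theorem finrank_span_pair {V : Type*} [AddCommGroup V] [Module K V] {u v : V}
    (h : LinearIndependent K ![u, v]) :
    Module.finrank K (Submodule.span K ({u, v} : Set V)) = 2 := by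
  rw [← Matrix.range_cons_cons_empty u v ![], finrank_span_eq_card h, Fintype.card_fin]

theorem span_pair_eq_of_finrank_eq_two {V : Type*} [AddCommGroup V] [Module K V]
    {W : Submodule K V} (hW : Module.finrank K W = 2) {u v : V} (hu : u ∈ W) (hv : v ∈ W)
    (h : LinearIndependent K ![u, v]) : Submodule.span K {u, v} = W := by
  have : FiniteDimensional K W := Module.finite_of_finrank_eq_succ hW
  refine Submodule.eq_of_le_of_finrank_eq ?_ (by rw [finrank_span_pair h, hW])
  rw [Submodule.span_le]
  rintro x (rfl | rfl)
  exacts [hu, hv]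

/-- The line through `(1, β, 0, β⁴)` and `(0, b, 1, λβ² + β⁸)`. -/
def ramsSchuettLine (lam b β : K) : Submodule K (Fin 4 → K) :=
  Submodule.span K {![1, β, 0, β ^ 4], ![0, b, 1, lam * β ^ 2 + β ^ 8]}

/-- The line through `(0, b, 1, 0)` and the point `(0, 0, 0, 1)`, which is singular on each
Rams–Schütt quartic in characteristic two. -/
def ramsSchuettSingularLine (b : K) : Submodule K (Fin 4 → K) :=
  Submodule.span K {![0, b, 1, 0], ![0, 0, 0, 1]}

theorem linearIndependent_pair_line (b β d t : K) :
    LinearIndependent K ![![1, β, 0, d], ![0, b, 1, t]] := by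
  rw [LinearIndependent.pair_iff]
  intro x y h
  have h0 := congrFun h 0
  have h2 := congrFun h 2
  simp_all

theorem linearIndependent_pair_singularLine (b : K) :
    LinearIndependent K ![![0, b, 1, 0], ![0, 0, 0, 1]] := by
  rw [LinearIndependent.pair_iff]
  intro x y h
  have h2 := congrFun h 2
  have h3 := congrFun h 3
  simp_all

theorem mem_ramsSchuettLine {lam b β : K} {v : Fin 4 → K} :
    v ∈ ramsSchuettLine lam b β ↔
      v 1 = v 0 * β + v 2 * b ∧ v 3 = v 0 * β ^ 4 + v 2 * (lam * β ^ 2 + β ^ 8) := by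
  rw [ramsSchuettLine, Submodule.mem_span_pair]
  constructor
  · rintro ⟨x, y, rfl⟩
    simp
  · rintro ⟨h1, h3⟩
    refine ⟨v 0, v 2, ?_⟩
    ext i
    fin_cases i <;> simp [h1, h3]

theorem mem_ramsSchuettSingularLine {b : K} {v : Fin 4 → K} :
    v ∈ ramsSchuettSingularLine b ↔ v 0 = 0 ∧ v 1 = v 2 * b := by
  rw [ramsSchuettSingularLine, Submodule.mem_span_pair]
  constructor
  · rintro ⟨x, y, rfl⟩
    simp
  · rintro ⟨h0, h1⟩
    refine ⟨v 2, v 3, ?_⟩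
    ext i
    fin_cases i <;> simp [h0, h1]

theorem ramsSchuettLine_inj {lam b β b' β' : K}
    (h : ramsSchuettLine lam b β = ramsSchuettLine lam b' β') : b = b' ∧ β = β' := by
  have h1 : ![1, β, 0, β ^ 4] ∈ ramsSchuettLine lam b' β' := h ▸ by simp [mem_ramsSchuettLine]
  have h2 : ![0, b, 1, lam * β ^ 2 + β ^ 8] ∈ ramsSchuettLine lam b' β' :=
    h ▸ by simp [mem_ramsSchuettLine]
  simp_all [mem_ramsSchuettLine]

theorem ramsSchuettSingularLine_injective :
    Function.Injective (ramsSchuettSingularLine : K → Submodule K (Fin 4 → K)) := by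
  intro b b' h
  have h1 : ![0, b, 1, 0] ∈ ramsSchuettSingularLine b' :=
    h ▸ by simp [mem_ramsSchuettSingularLine]
  simpa [mem_ramsSchuettSingularLine] using h1

theorem ramsSchuettLine_ne_singularLine (lam b β b' : K) :
    ramsSchuettLine lam b β ≠ ramsSchuettSingularLine b' := by
  intro h
  have h1 : ![1, β, 0, β ^ 4] ∈ ramsSchuettSingularLine b' :=
    h ▸ by simp [mem_ramsSchuettLine]
  simp [mem_ramsSchuettSingularLine] at h1

/-- The lines contained in `X_λ`. -/
def linesOnRamsSchuett (lam : K) : Set (Submodule K (Fin 4 → K)) :=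
  {W | Module.finrank K W = 2 ∧ ∀ v ∈ W, eval v (ramsSchuett K lam) = 0}

theorem ramsSchuettSingularLine_mem {b : K} (lam : K) (hb : b ^ 4 + b = 0) :
    ramsSchuettSingularLine b ∈ linesOnRamsSchuett lam := by
  refine ⟨finrank_span_pair (linearIndependent_pair_singularLine b), fun v hv => ?_⟩
  obtain ⟨h0, h1⟩ := mem_ramsSchuettSingularLine.1 hv
  rw [eval_ramsSchuett, h0, h1]
  linear_combination v 2 ^ 4 * hb

theorem ramsSchuettLine_mem [CharP K 2] {lam b β : K} (hb : b ^ 4 + b = 0)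
    (hβ : β ^ 16 + lam ^ 2 * β ^ 4 + β + lam * b ^ 2 = 0) :
    ramsSchuettLine lam b β ∈ linesOnRamsSchuett lam := by
  refine ⟨finrank_span_pair (linearIndependent_pair_line _ _ _ _), fun v hv => ?_⟩
  obtain ⟨h1, h3⟩ := mem_ramsSchuettLine.1 hv
  have h2 : (2 : K) = 0 := CharTwo.two_eq_zero
  rw [eval_ramsSchuett, h1, h3]
  grind

theorem coeff_eq_zero_of_forall_quartic_eq_zero [Infinite K] {c₀ c₁ c₂ c₃ c₄ : K}
    (h : ∀ s : K, c₀ + c₁ * s + c₂ * s ^ 2 + c₃ * s ^ 3 + c₄ * s ^ 4 = 0) :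
    c₀ = 0 ∧ c₁ = 0 ∧ c₂ = 0 ∧ c₃ = 0 ∧ c₄ = 0 := by
  have hp : (Polynomial.C c₀ + Polynomial.C c₁ * Polynomial.X + Polynomial.C c₂ * Polynomial.X ^ 2
      + Polynomial.C c₃ * Polynomial.X ^ 3 + Polynomial.C c₄ * Polynomial.X ^ 4) = 0 :=
    Polynomial.funext fun s => by simpa using h s
  have hc (n : ℕ) := congrArg (fun p => Polynomial.coeff p n) hp
  refine ⟨?_, ?_, ?_, ?_, ?_⟩
  · simpa [Polynomial.coeff_X, Polynomial.coeff_X_pow, Polynomial.coeff_C] using hc 0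
  · simpa [Polynomial.coeff_X, Polynomial.coeff_X_pow, Polynomial.coeff_C] using hc 1
  · simpa [Polynomial.coeff_X, Polynomial.coeff_X_pow, Polynomial.coeff_C] using hc 2
  · simpa [Polynomial.coeff_X, Polynomial.coeff_X_pow, Polynomial.coeff_C] using hc 3
  · simpa [Polynomial.coeff_X, Polynomial.coeff_X_pow, Polynomial.coeff_C] using hc 4

theorem single_three_mem {lam : K} {W : Submodule K (Fin 4 → K)}
    (hF : ∀ v ∈ W, eval v (ramsSchuett K lam) = 0) {w : Fin 4 → K} (hw : w ∈ W) (hw_ne : w ≠ 0)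
    (h0 : w 0 = 0) (h2 : w 2 = 0) : ![0, 0, 0, 1] ∈ W := by
  have h1 : w 1 = 0 := by simpa [eval_ramsSchuett, h0, h2] using hF w hw
  have h3 : w 3 ≠ 0 := fun h3 => hw_ne <| by ext i; fin_cases i <;> simp [h0, h1, h2, h3]
  convert W.smul_mem (w 3)⁻¹ hw using 1
  ext i
  fin_cases i <;> simp [h0, h1, h2, h3]

theorem eq_singularLine_of_forall_apply_zero {lam : K} {W : Submodule K (Fin 4 → K)}
    (hW : W ∈ linesOnRamsSchuett lam) (h0 : ∀ v ∈ W, v 0 = 0) :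
    ∃ b : K, b ^ 4 + b = 0 ∧ W = ramsSchuettSingularLine b := by
  obtain ⟨hdim, hF⟩ := hW
  obtain ⟨w, hw, hw_ne, hw2⟩ :=
    exists_ne_zero_apply_eq_zero_of_finrank_eq_two hdim (LinearMap.proj 2)
  have he := single_three_mem hF hw hw_ne (h0 w hw) hw2
  obtain ⟨u, hu, hu_ne, hu3⟩ :=
    exists_ne_zero_apply_eq_zero_of_finrank_eq_two hdim (LinearMap.proj 3)
  simp only [LinearMap.proj_apply] at hu3
  have hu0 := h0 u hu
  have hFu := hF u hu
  rw [eval_ramsSchuett] at hFu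
  have hu2 : u 2 ≠ 0 := fun hu2 => hu_ne <| by
    have hu1 : u 1 = 0 := by simpa [hu0, hu2] using hFu
    ext i
    fin_cases i <;> simp [hu0, hu1, hu2, hu3]
  refine ⟨u 1 / u 2, ?_, (span_pair_eq_of_finrank_eq_two hdim ?_ he
    (linearIndependent_pair_singularLine _)).symm⟩
  · simp only [hu0] at hFu
    field_simp
    linear_combination hFu
  · convert W.smul_mem (u 2)⁻¹ hu using 1
    ext i
    fin_cases i <;> simp [hu0, hu2, hu3, div_eq_inv_mul]

theorem eq_line_of_apply_zero_ne_zero [Infinite K] [CharP K 2] {lam : K}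
    {W : Submodule K (Fin 4 → K)} (hW : W ∈ linesOnRamsSchuett lam) {v : Fin 4 → K} (hv : v ∈ W)
    (hv0 : v 0 ≠ 0) :
    ∃ b β : K, b ^ 4 + b = 0 ∧ β ^ 16 + lam ^ 2 * β ^ 4 + β + lam * b ^ 2 = 0 ∧
      W = ramsSchuettLine lam b β := by
  obtain ⟨hdim, hF⟩ := hW
  have hchar : (2 : K) = 0 := CharTwo.two_eq_zero
  obtain ⟨w, hw, hw_ne, hw0⟩ :=
    exists_ne_zero_apply_eq_zero_of_finrank_eq_two hdim (LinearMap.proj 0)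
  simp only [LinearMap.proj_apply] at hw0
  have hw2 : w 2 ≠ 0 := by
    intro hw2
    have he := single_three_mem hF hw hw_ne hw0 hw2
    have hs (s : K) := hF _ (W.add_mem hv (W.smul_mem s he))
    simp only [eval_ramsSchuett] at hs
    have := coeff_eq_zero_of_forall_quartic_eq_zero
      (c₀ := lam * (v 0 * v 1 ^ 2 * v 2) + v 1 ^ 4 + v 1 * v 2 ^ 3
        + v 0 ^ 3 * v 3 + v 0 * v 2 * v 3 ^ 2) (c₁ := v 0 ^ 3) (c₂ := v 0 * v 2) (c₃ := 0)
      (c₄ := 0) fun s => by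
        have := hs s
        simp at this
        linear_combination this - v 0 * v 2 * v 3 * s * hchar
    exact hv0 (by simpa using this.2.1)
  obtain ⟨b, t, hq⟩ : ∃ b t : K, ![0, b, 1, t] ∈ W := by
    refine ⟨(w 2)⁻¹ * w 1, (w 2)⁻¹ * w 3, ?_⟩
    convert W.smul_mem (w 2)⁻¹ hw using 1
    ext i
    fin_cases i <;> simp [hw0, hw2]
  obtain ⟨β, d, hp⟩ : ∃ β d : K, ![1, β, 0, d] ∈ W := by
    refine ⟨(v 0)⁻¹ * (v 1 - v 2 * b), (v 0)⁻¹ * (v 3 - v 2 * t), ?_⟩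
    convert W.smul_mem (v 0)⁻¹ (W.sub_mem hv (W.smul_mem (v 2) hq)) using 1
    ext i
    fin_cases i <;> simp [hv0, Matrix.vecHead, Matrix.vecTail]
  have hs (s : K) := hF _ (W.add_mem hp (W.smul_mem s hq))
  simp only [eval_ramsSchuett] at hs
  obtain ⟨hd, ht, -, hβ, hb⟩ := coeff_eq_zero_of_forall_quartic_eq_zero
    (c₀ := β ^ 4 + d) (c₁ := lam * β ^ 2 + t + d ^ 2) (c₂ := 0) (c₃ := lam * b ^ 2 + β + t ^ 2)
    (c₄ := b ^ 4 + b) fun s => by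
      have := hs s
      simp at this
      grind
  obtain rfl : d = β ^ 4 := by grind
  obtain rfl : t = lam * β ^ 2 + β ^ 8 := by grind
  refine ⟨b, β, hb, by grind, ?_⟩
  exact (span_pair_eq_of_finrank_eq_two hdim hp hq (linearIndependent_pair_line _ _ _ _)).symm

theorem card_toFinset_roots_of_derivative_eq_one [IsAlgClosed K] [DecidableEq K]
    {p : Polynomial K} (hp : Polynomial.derivative p = 1) :
    p.roots.toFinset.card = p.natDegree := by
  have hsep : p.Separable := by rw [Polynomial.Separable, hp]; exact isCoprime_one_right
  rw [Multiset.toFinset_card_of_nodup (Polynomial.nodup_roots hsep)]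
  exact (IsAlgClosed.splits p).natDegree_eq_card_roots.symm

theorem exists_finset_mem_iff_pow_four [IsAlgClosed K] [CharP K 2] :
    ∃ A : Finset K, A.card = 4 ∧ ∀ b, b ∈ A ↔ b ^ 4 + b = 0 := by
  classical
  have hchar : (2 : Polynomial K) = 0 := CharTwo.two_eq_zero
  have hdeg : (Polynomial.X ^ 4 + Polynomial.X : Polynomial K).natDegree = 4 := by compute_degree!
  refine ⟨(Polynomial.X ^ 4 + Polynomial.X : Polynomial K).roots.toFinset, ?_, fun b => ?_⟩
  · rw [card_toFinset_roots_of_derivative_eq_one, hdeg]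
    simp only [Polynomial.derivative_add, Polynomial.derivative_X_pow, Polynomial.derivative_X,
      Nat.cast_ofNat, map_ofNat]
    linear_combination 2 * Polynomial.X ^ 3 * hchar
  · rw [Multiset.mem_toFinset, Polynomial.mem_roots (Polynomial.ne_zero_of_natDegree_gt
      (hdeg.symm ▸ Nat.zero_lt_succ 3 : 0 < _))]
    simp

theorem exists_finset_mem_iff_pow_sixteen [IsAlgClosed K] [CharP K 2] (r s : K) :
    ∃ B : Finset K, B.card = 16 ∧ ∀ β, β ∈ B ↔ β ^ 16 + r * β ^ 4 + β + s = 0 := by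
  classical
  have hchar : (2 : Polynomial K) = 0 := CharTwo.two_eq_zero
  set p : Polynomial K := Polynomial.X ^ 16 + Polynomial.C r * Polynomial.X ^ 4 + Polynomial.X
    + Polynomial.C s with hp
  have hdeg : p.natDegree = 16 := by rw [hp]; compute_degree!
  refine ⟨p.roots.toFinset, ?_, fun β => ?_⟩
  · rw [card_toFinset_roots_of_derivative_eq_one, hdeg]
    simp only [hp, Polynomial.derivative_add, Polynomial.derivative_X_pow,
      Polynomial.derivative_C_mul, Polynomial.derivative_X, Polynomial.derivative_C,
      Nat.cast_ofNat, map_ofNat]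
    linear_combination (8 * Polynomial.X ^ 15 + 2 * Polynomial.C r * Polynomial.X ^ 3) * hchar
  · rw [Multiset.mem_toFinset, Polynomial.mem_roots (Polynomial.ne_zero_of_natDegree_gt
      (hdeg.symm ▸ Nat.zero_lt_succ 15 : 0 < _))]
    simp [hp]

theorem exists_finset_coe_eq_linesOnRamsSchuett [IsAlgClosed K] [CharP K 2] (lam : K) :
    ∃ T : Finset (Submodule K (Fin 4 → K)), T.card = 68 ∧ ↑T = linesOnRamsSchuett lam := by
  classical
  have : Infinite K := IsAlgClosed.instInfinite
  obtain ⟨A, hA, hmemA⟩ := exists_finset_mem_iff_pow_four (K := K)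
  choose B hB hmemB using fun b : K =>
    exists_finset_mem_iff_pow_sixteen (lam ^ 2) (lam * b ^ 2)
  refine ⟨(A.sigma B).image (fun x => ramsSchuettLine lam x.1 x.2) ∪
    A.image ramsSchuettSingularLine, ?_, ?_⟩
  · rw [Finset.card_union_of_disjoint, Finset.card_image_of_injective,
      Finset.card_image_of_injective _ ramsSchuettSingularLine_injective, Finset.card_sigma]
    · simp [hB, hA]
    · rintro ⟨b, β⟩ ⟨b', β'⟩ h
      obtain ⟨rfl, rfl⟩ := ramsSchuettLine_inj h
      rfl
    · rw [Finset.disjoint_left]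
      intro W h h'
      obtain ⟨x, -, rfl⟩ := Finset.mem_image.1 h
      obtain ⟨b, -, hb⟩ := Finset.mem_image.1 h'
      exact ramsSchuettLine_ne_singularLine _ _ _ _ hb.symm
  · ext W
    simp only [Finset.coe_union, Finset.coe_image, Set.mem_union, Set.mem_image, Finset.mem_coe,
      Finset.mem_sigma, hmemA, hmemB]
    constructor
    · rintro (⟨x, ⟨hb, hβ⟩, rfl⟩ | ⟨b, hb, rfl⟩)
      · exact ramsSchuettLine_mem hb hβ
      · exact ramsSchuettSingularLine_mem lam hb
    · intro hW
      by_cases h0 : ∀ v ∈ W, v 0 = 0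
      · obtain ⟨b, hb, rfl⟩ := eq_singularLine_of_forall_apply_zero hW h0
        exact Or.inr ⟨b, hb, rfl⟩
      · push Not at h0
        obtain ⟨v, hv, hv0⟩ := h0
        obtain ⟨b, β, hb, hβ, rfl⟩ := eq_line_of_apply_zero_ne_zero hW hv hv0
        exact Or.inl ⟨⟨b, β⟩, ⟨hb, hβ⟩, rfl⟩

end RamsSchuettLines

/-- Over an algebraically closed field of characteristic 2, each member
`X_λ` (`λ ≠ 0`) of the Rams–Schütt family contains exactly 68 lines.  Lines of ℙ³ are
represented by 2-dimensional linear subspaces of `K⁴`. -/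
theorem ramsSchuett_exactly_68_lines
    (K : Type*) [Field K] [IsAlgClosed K] [CharP K 2] (lam : K) (hlam : lam ≠ 0) :
    {W : Submodule K (Fin 4 → K) |
        Module.finrank K W = 2 ∧ ∀ v ∈ W, eval v (ramsSchuett K lam) = 0}.Finite ∧
    {W : Submodule K (Fin 4 → K) |
        Module.finrank K W = 2 ∧ ∀ v ∈ W, eval v (ramsSchuett K lam) = 0}.ncard = 68 := by
  obtain ⟨T, hcard, hT⟩ := exists_finset_coe_eq_linesOnRamsSchuett lam
  change (linesOnRamsSchuett lam).Finite ∧ (linesOnRamsSchuett lam).ncard = 68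
  rw [← hT, Set.ncard_coe_finset]
  exact ⟨T.finite_toSet, hcard⟩
end

section
/- Let K be an algebraically closed field of characteristic 2, λ ∈ K with λ ≠ 0, and let X_λ ⊂ ℙ³ be the quartic surface defined by F_λ = λ·x₀x₁²x₂ + x₁⁴ + x₁x₂³ + x₀³x₃ + x₀x₂x₃². Then the set of singular points of X_λ is exactly the single point {[0:0:0:1]}; that is, [0:0:0:1] lies on X_λ, all four partial derivatives of F_λ vanish there, and at every other point of X_λ some partial derivative of F_λ is nonzero. -/
open MvPolynomial

/-- The singular locus of a member `X_λ` (`λ ≠ 0`) of the Rams–Schütt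
family is exactly the single point `[0:0:0:1]`: this point lies on `X_λ` and all four
partial derivatives vanish there, while at every point of `X_λ` not equal to
`[0:0:0:1]` (i.e. represented by a nonzero vector that is not a scalar multiple of
`(0,0,0,1)`) some partial derivative is nonzero. -/
theorem ramsSchuett_singular_locus
    (K : Type*) [Field K] [IsAlgClosed K] [CharP K 2] (lam : K) (hlam : lam ≠ 0) :
    eval (![0, 0, 0, 1] : Fin 4 → K) (ramsSchuett K lam) = 0 ∧
    (∀ i : Fin 4, eval (![0, 0, 0, 1] : Fin 4 → K) (pderiv i (ramsSchuett K lam)) = 0) ∧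
    (∀ v : Fin 4 → K, v ≠ 0 → eval v (ramsSchuett K lam) = 0 →
      (¬ ∃ c : K, v = c • ![0, 0, 0, 1]) →
      ∃ i : Fin 4, eval v (pderiv i (ramsSchuett K lam)) ≠ 0) := by
  have h2 : (2 : K) = 0 := CharTwo.two_eq_zero
  refine ⟨?_, ?_, ?_⟩
  · simp [ramsSchuett]
  · intro i
    fin_cases i <;> simp [ramsSchuett, pderiv_X]
  · intro v _ hF hv
    by_contra! h
    have d1 := h 1
    have d3 := h 3
    simp [ramsSchuett, pderiv_X] at hF d1 d3
    have hc : v 2 = 0 := by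
      refine pow_eq_zero_iff (n := 3) (by norm_num) |>.mp ?_
      linear_combination d1 - (lam * v 0 * v 1 * v 2 + 2 * v 1 ^ 3) * h2
    have ha : v 0 = 0 := by
      refine pow_eq_zero_iff (n := 3) (by norm_num) |>.mp ?_
      linear_combination d3 - (v 0 * v 2 * v 3) * h2
    have hb : v 1 = 0 := by
      simpa [ha, hc] using hF
    refine hv ⟨v 3, ?_⟩
    ext i
    fin_cases i <;> simp [ha, hb, hc]
end

section
/- Let K be an algebraically closed field of characteristic 2 and let X ⊂ ℙ³ be the quartic surface defined by x₀³x₁ + x₀x₁³ + x₀x₂³ + x₀²x₁x₃ + x₁x₂²x₃ + x₀²x₃² + x₁²x₃² + x₀x₃³ = 0. Then the line ℓ : x₀ = x₁ = 0 lies on X, and exactly 16 lines lying on X and distinct from ℓ have nonempty intersection with ℓ. -/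
open MvPolynomial

/-- The quartic `x₀³x₁ + x₀x₁³ + x₀x₂³ + x₀²x₁x₃ + x₁x₂²x₃ + x₀²x₃² + x₁²x₃² + x₀x₃³`. -/
noncomputable def exQuartic (K : Type*) [Field K] : MvPolynomial (Fin 4) K :=
  X 0 ^ 3 * X 1 + X 0 * X 1 ^ 3 + X 0 * X 2 ^ 3 + X 0 ^ 2 * X 1 * X 3
    + X 1 * X 2 ^ 2 * X 3 + X 0 ^ 2 * X 3 ^ 2 + X 1 ^ 2 * X 3 ^ 2 + X 0 * X 3 ^ 3

/-- A cubic polynomial function vanishing on an infinite field has zero coefficients. -/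
theorem cubic_coeff_eq_zero {K : Type*} [Field K] [Infinite K] {k₀ k₁ k₂ k₃ : K}
    (h : ∀ a : K, k₃ * a ^ 3 + k₂ * a ^ 2 + k₁ * a + k₀ = 0) :
    k₃ = 0 ∧ k₂ = 0 ∧ k₁ = 0 ∧ k₀ = 0 := by
  have hp : (Cubic.mk k₃ k₂ k₁ k₀).toPoly = 0 :=
    Polynomial.funext fun a => by simpa [Cubic.toPoly] using h a
  have := (Cubic.toPoly_eq_zero_iff _).1 hp
  exact Cubic.ext_iff.1 this

theorem eval_exQuartic {K : Type*} [Field K] (v : Fin 4 → K) :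
    eval v (exQuartic K) = v 0 ^ 3 * v 1 + v 0 * v 1 ^ 3 + v 0 * v 2 ^ 3 + v 0 ^ 2 * v 1 * v 3
      + v 1 * v 2 ^ 2 * v 3 + v 0 ^ 2 * v 3 ^ 2 + v 1 ^ 2 * v 3 ^ 2 + v 0 * v 3 ^ 3 := by
  simp [exQuartic]

theorem mem_baseLine_iff {K : Type*} [Field K] {v : Fin 4 → K} :
    v ∈ Submodule.span K {![0, 0, 1, 0], ![0, 0, 0, 1]} ↔ v 0 = 0 ∧ v 1 = 0 := by
  rw [Submodule.mem_span_pair]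
  constructor
  · rintro ⟨a, b, rfl⟩
    simp
  · rintro ⟨h0, h1⟩
    refine ⟨v 2, v 3, ?_⟩
    ext i
    fin_cases i <;> simp [h0, h1]

/-- Vectors `p`, `v` with `p` on `ℓ` and `v` off `ℓ` are linearly independent. -/
theorem finrank_span_pair_of_baseLine {K : Type*} [Field K] {p v : Fin 4 → K}
    (hp : p ≠ 0) (hp0 : p 0 = 0) (hp1 : p 1 = 0) (hv : ¬(v 0 = 0 ∧ v 1 = 0)) :
    Module.finrank K (Submodule.span K {p, v}) = 2 := by
  have hli : LinearIndependent K ![p, v] := by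
    rw [LinearIndependent.pair_iff]
    intro s t h
    have ht : t = 0 := by
      by_contra ht
      have h0 := congrFun h 0
      have h1 := congrFun h 1
      simp [hp0, hp1, ht] at h0 h1
      exact hv ⟨h0, h1⟩
    subst ht
    simpa [hp] using h
  rw [← Matrix.range_cons_cons_empty p v ![], finrank_span_eq_card hli, Fintype.card_fin]

theorem eq_span_pair_of_baseLine {K : Type*} [Field K] {W : Submodule K (Fin 4 → K)}
    (hW : Module.finrank K W = 2) {p v : Fin 4 → K} (hpW : p ∈ W) (hvW : v ∈ W)
    (hp : p ≠ 0) (hp0 : p 0 = 0) (hp1 : p 1 = 0) (hv : ¬(v 0 = 0 ∧ v 1 = 0)) :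
    W = Submodule.span K {p, v} := by
  symm
  apply Submodule.eq_of_le_of_finrank_eq
  · rw [Submodule.span_le]
    rintro x (rfl | rfl) <;> assumption
  · rw [finrank_span_pair_of_baseLine hp hp0 hp1 hv, hW]

/-- The line `x₀ = x₃ = 0`. -/
def lineAtInfinity (K : Type*) [Field K] : Submodule K (Fin 4 → K) :=
  Submodule.span K {![0, 0, 1, 0], ![0, 1, 0, 0]}

/-- The line through `(0 : 0 : r : 1)` in the plane `x₁ = (r + r⁻²) x₀` which lies on the quartic
when `r ^ 15 + r ^ 8 + 1 = 0`. -/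
def rootLine {K : Type*} [Field K] (r : K) : Submodule K (Fin 4 → K) :=
  Submodule.span K {![0, 0, r, 1], ![1, r + r⁻¹ ^ 2, 1 + r⁻¹ ^ 2 + r⁻¹ ^ 6, 0]}

/-- The set of lines on the quartic, distinct from `ℓ` and meeting `ℓ`. -/
def linesMeetingBaseLine (K : Type*) [Field K] : Set (Submodule K (Fin 4 → K)) :=
  {W : Submodule K (Fin 4 → K) |
        Module.finrank K W = 2 ∧ (∀ v ∈ W, eval v (exQuartic K) = 0) ∧
        W ≠ Submodule.span K {![0, 0, 1, 0], ![0, 0, 0, 1]} ∧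
        W ⊓ Submodule.span K {![0, 0, 1, 0], ![0, 0, 0, 1]} ≠ ⊥}

theorem span_pair_mem_linesMeetingBaseLine {K : Type*} [Field K] {p v : Fin 4 → K}
    (hp : p ≠ 0) (hp0 : p 0 = 0) (hp1 : p 1 = 0) (hv : ¬(v 0 = 0 ∧ v 1 = 0))
    (h : ∀ a b : K, eval (a • p + b • v) (exQuartic K) = 0) :
    Submodule.span K {p, v} ∈ linesMeetingBaseLine K := by
  refine ⟨finrank_span_pair_of_baseLine hp hp0 hp1 hv, ?_, ?_, ?_⟩
  · intro w hw
    obtain ⟨a, b, rfl⟩ := Submodule.mem_span_pair.1 hw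
    exact h a b
  · intro heq
    exact hv (mem_baseLine_iff.1 (heq ▸ Submodule.subset_span (by simp)))
  · rw [Submodule.ne_bot_iff]
    exact ⟨p, ⟨Submodule.subset_span (by simp), mem_baseLine_iff.2 ⟨hp0, hp1⟩⟩, hp⟩

theorem lineAtInfinity_mem (K : Type*) [Field K] :
    lineAtInfinity K ∈ linesMeetingBaseLine K := by
  refine span_pair_mem_linesMeetingBaseLine ?_ (by simp) (by simp) (by simp) ?_
  · intro h
    simpa using congrFun h 2
  · intro a b
    simp [eval_exQuartic]

theorem rootLine_mem {K : Type*} [Field K] [CharP K 2] {r : K} (hr : r ^ 15 + r ^ 8 + 1 = 0) :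
    rootLine r ∈ linesMeetingBaseLine K := by
  have h2 : (2 : K) = 0 := CharTwo.two_eq_zero
  have hr0 : r ≠ 0 := by
    rintro rfl
    simp at hr
  refine span_pair_mem_linesMeetingBaseLine ?_ (by simp) (by simp) (by simp) ?_
  · intro h
    simpa using congrFun h 3
  · intro a b
    have hru : r * r⁻¹ = 1 := mul_inv_cancel₀ hr0
    set u := r⁻¹ with hu
    have hu15 : 1 + u ^ 7 + u ^ 15 = 0 := by
      rw [hu]
      field_simp
      linear_combination hr
    obtain ⟨t, ht⟩ : ∃ t, t = r + u ^ 2 := ⟨_, rfl⟩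
    obtain ⟨c, hc⟩ : ∃ c, c = 1 + u ^ 2 + u ^ 6 := ⟨_, rfl⟩
    have k3 : r ^ 3 + t * r ^ 2 + 1 = 0 := by grind
    have k2 : 1 + t ^ 2 + r ^ 2 * c = 0 := by grind
    have k1 : t + r * c ^ 2 + t * c ^ 2 = 0 := by grind
    have k0 : t + t ^ 3 + c ^ 3 = 0 := by grind
    rw [← ht, ← hc]
    simp only [eval_exQuartic]
    simp
    linear_combination b * a ^ 3 * k3 + b ^ 2 * a ^ 2 * k2 + b ^ 3 * a * k1 + b ^ 4 * k0
      + (b ^ 2 * a ^ 2 * r ^ 2 * c + b ^ 3 * a * r * c ^ 2 + b ^ 2 * a ^ 2 * t * r * c) * h2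

/-- Solving the vanishing equations for the coefficients of the quartic on the line spanned by
`(0, 0, r, 1)` and `(1, t, c, 0)`. -/
theorem root_of_coeff_eq_zero {K : Type*} [Field K] [CharP K 2] {r t c : K} (hr0 : r ≠ 0)
    (k3 : r ^ 3 + t * r ^ 2 + 1 = 0) (k2 : 1 + t ^ 2 + r ^ 2 * c = 0)
    (k1 : t + r * c ^ 2 + t * c ^ 2 = 0) :
    r ^ 15 + r ^ 8 + 1 = 0 ∧ t = r + r⁻¹ ^ 2 ∧ c = 1 + r⁻¹ ^ 2 + r⁻¹ ^ 6 := by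
  have h2 : (2 : K) = 0 := CharTwo.two_eq_zero
  have hru : r * r⁻¹ = 1 := mul_inv_cancel₀ hr0
  generalize r⁻¹ = u at *
  have ht : t = r + u ^ 2 := by
    grind
  subst ht
  have hc : c = 1 + u ^ 2 + u ^ 6 := by
    grind
  subst hc
  grind

theorem eq_of_mem_linesMeetingBaseLine {K : Type*} [Field K] [Infinite K] [CharP K 2]
    {W : Submodule K (Fin 4 → K)} (hW : W ∈ linesMeetingBaseLine K) :
    W = lineAtInfinity K ∨ ∃ r : K, r ^ 15 + r ^ 8 + 1 = 0 ∧ W = rootLine r := by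
  have h2 : (2 : K) = 0 := CharTwo.two_eq_zero
  obtain ⟨hdim, hF, hne, hmeet⟩ := hW
  obtain ⟨p, ⟨hpW, hpl⟩, hp⟩ := (Submodule.ne_bot_iff _).1 hmeet
  obtain ⟨hp0, hp1⟩ := mem_baseLine_iff.1 hpl
  obtain ⟨v, hvW, hv⟩ : ∃ v ∈ W, ¬(v 0 = 0 ∧ v 1 = 0) := by
    by_contra hcon
    push Not at hcon
    refine hne (Submodule.eq_of_le_of_finrank_le (fun v hv => mem_baseLine_iff.2 (hcon v hv)) ?_)
    rw [hdim, ← Matrix.range_cons_cons_empty _ _ ![]]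
    exact finrank_range_le_card _
  have hF' : ∀ a : K, eval (a • p + v) (exQuartic K) = 0 := fun a =>
    hF _ (W.add_mem (W.smul_mem a hpW) hvW)
  simp only [eval_exQuartic] at hF'
  simp only [Pi.add_apply, Pi.smul_apply, smul_eq_mul, hp0, hp1, mul_zero, zero_add] at hF'
  have hp23 : ¬(p 2 = 0 ∧ p 3 = 0) := by
    rintro ⟨h2, h3⟩
    apply hp
    ext i
    fin_cases i <;> simp [*]
  by_cases hv0 : v 0 = 0
  · left
    have hv1 : v 1 ≠ 0 := fun h => hv ⟨hv0, h⟩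
    obtain ⟨e3, e2, -, e0⟩ := cubic_coeff_eq_zero (k₃ := v 1 * (p 2 ^ 2 * p 3))
      (k₂ := v 1 * (p 2 ^ 2 * v 3 + v 1 * p 3 ^ 2)) (k₁ := v 1 * v 2 ^ 2 * p 3)
      (k₀ := v 1 * (v 2 ^ 2 * v 3 + v 1 * v 3 ^ 2)) fun a => by
        have := hF' a
        simp only [hv0] at this
        linear_combination this - (v 1 * a * p 2 * v 2 * (a * p 3 + v 3)
          + v 1 ^ 2 * a * p 3 * v 3) * h2
    have hp3 : p 3 = 0 := by
      by_contra hp3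
      have hp2 : p 2 = 0 := by simpa [hv1, hp3] using e3
      simp [hv1, hp2, hp3] at e2
    have hp2 : p 2 ≠ 0 := fun h => hp23 ⟨h, hp3⟩
    have hv3 : v 3 = 0 := by simpa [hv1, hp2, hp3] using e2
    refine eq_span_pair_of_baseLine hdim ?_ ?_ ?_ (by simp) (by simp) (by simp)
    · convert W.smul_mem (p 2)⁻¹ hpW using 1
      ext i
      fin_cases i <;> simp [*]
    · convert W.smul_mem (v 1)⁻¹ (W.sub_mem hvW (W.smul_mem (v 2 * (p 2)⁻¹) hpW)) using 1
      ext i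
      fin_cases i <;> simp [*]
    · intro h
      simpa using congrFun h 2
  · right
    have hp3 : p 3 ≠ 0 := by
      intro hp3
      have hp2 : p 2 ≠ 0 := fun h => hp23 ⟨h, hp3⟩
      obtain ⟨e3, -⟩ := cubic_coeff_eq_zero (k₃ := v 0 * p 2 ^ 3)
        (k₂ := v 0 * p 2 ^ 2 * v 2 + v 1 * p 2 ^ 2 * v 3) (k₁ := v 0 * p 2 * v 2 ^ 2)
        (k₀ := v 0 ^ 3 * v 1 + v 0 * v 1 ^ 3 + v 0 * v 2 ^ 3 + v 0 ^ 2 * v 1 * v 3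
          + v 1 * v 2 ^ 2 * v 3 + v 0 ^ 2 * v 3 ^ 2 + v 1 ^ 2 * v 3 ^ 2 + v 0 * v 3 ^ 3)
        fun a => by
          have := hF' a
          simp only [hp3] at this
          linear_combination this - (v 0 * (a ^ 2 * p 2 ^ 2 * v 2 + a * p 2 * v 2 ^ 2)
            + v 1 * a * p 2 * v 2 * v 3) * h2
      simp [hv0, hp2] at e3
    obtain ⟨r, hr⟩ : ∃ r, r = p 2 * (p 3)⁻¹ := ⟨_, rfl⟩
    obtain ⟨t, ht⟩ : ∃ t, t = (v 0)⁻¹ * v 1 := ⟨_, rfl⟩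
    obtain ⟨c, hc⟩ : ∃ c, c = (v 0)⁻¹ * (v 2 - v 3 * r) := ⟨_, rfl⟩
    have hpW' : ![0, 0, r, 1] ∈ W := by
      convert W.smul_mem (p 3)⁻¹ hpW using 1
      ext i
      fin_cases i <;> simp [*, mul_comm]
    have hvW' : ![1, t, c, 0] ∈ W := by
      convert W.smul_mem (v 0)⁻¹ (W.sub_mem hvW (W.smul_mem (v 3) hpW')) using 1
      ext i
      fin_cases i <;> simp [*, Matrix.vecHead, Matrix.vecTail]
    obtain ⟨k3, k2, k1, k0⟩ := cubic_coeff_eq_zero (k₃ := r ^ 3 + t * r ^ 2 + 1)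
      (k₂ := 1 + t ^ 2 + r ^ 2 * c) (k₁ := t + r * c ^ 2 + t * c ^ 2) (k₀ := t + t ^ 3 + c ^ 3)
      fun a => by
        have := hF _ (W.add_mem (W.smul_mem a hpW') hvW')
        simp only [eval_exQuartic] at this
        simp at this
        linear_combination this - (a ^ 2 * r ^ 2 * c + a * r * c ^ 2 + a ^ 2 * t * r * c) * h2
    have hr0 : r ≠ 0 := by
      rintro rfl
      simp at k3
    obtain ⟨hr15, ht', hc'⟩ := root_of_coeff_eq_zero hr0 k3 k2 k1
    refine ⟨r, hr15, ?_⟩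
    clear hr ht hc
    subst ht' hc'
    refine eq_span_pair_of_baseLine hdim hpW' hvW' ?_ (by simp) (by simp) (by simp)
    intro h
    simpa using congrFun h 3

theorem rootLine_injective {K : Type*} [Field K] : Function.Injective (rootLine (K := K)) := by
  intro r s h
  have hm : ![0, 0, r, 1] ∈ rootLine s := h ▸ Submodule.subset_span (by simp)
  obtain ⟨a, b, hab⟩ := Submodule.mem_span_pair.1 hm
  have hb : b = 0 := by simpa using congrFun hab 0
  have ha : a = 1 := by simpa using congrFun hab 3
  have h2 := congrFun hab 2
  simp [ha, hb] at h2
  exact h2.symm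

theorem lineAtInfinity_ne_rootLine {K : Type*} [Field K] (r : K) :
    lineAtInfinity K ≠ rootLine r := by
  intro h
  have hm : ![0, 0, r, 1] ∈ lineAtInfinity K := h ▸ Submodule.subset_span (by simp)
  obtain ⟨a, b, hab⟩ := Submodule.mem_span_pair.1 hm
  simpa using congrFun hab 3

open Polynomial in
theorem ncard_roots_eq_fifteen (K : Type*) [Field K] [IsAlgClosed K] [CharP K 2] :
    {r : K | r ^ 15 + r ^ 8 + 1 = 0}.Finite ∧ {r : K | r ^ 15 + r ^ 8 + 1 = 0}.ncard = 15 := by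
  have h2 : (2 : K[X]) = 0 := CharTwo.two_eq_zero
  let P : K[X] := .X ^ 15 + .X ^ 8 + 1
  have hdeg : P.natDegree = 15 := by
    simp only [P]
    compute_degree!
  have hP0 : P ≠ 0 := by
    intro h
    simp [h] at hdeg
  have hder : derivative P = .X ^ 14 := by
    simp only [P, derivative_add, derivative_X_pow, derivative_one, map_natCast]
    norm_num
    linear_combination (7 * .X ^ 14 + 4 * .X ^ 7) * h2
  have hsep : P.Separable := by
    rw [separable_def, hder]
    refine IsCoprime.pow_right ⟨1, .X ^ 14 + .X ^ 7, ?_⟩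
    linear_combination (.X ^ 15 + .X ^ 8) * h2
  have hset : {r : K | r ^ 15 + r ^ 8 + 1 = 0} = P.rootSet K := by
    ext r
    simp [mem_rootSet, hP0, P]
  rw [hset]
  refine ⟨P.rootSet_finite K, ?_⟩
  rw [← Nat.card_coe_set_eq, Nat.card_eq_fintype_card,
    card_rootSet_eq_natDegree hsep (IsAlgClosed.splits _), hdeg]

theorem linesMeetingBaseLine_eq (K : Type*) [Field K] [Infinite K] [CharP K 2] :
    linesMeetingBaseLine K =
      insert (lineAtInfinity K) (rootLine '' {r : K | r ^ 15 + r ^ 8 + 1 = 0}) := by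
  ext W
  constructor
  · intro hW
    obtain h | ⟨r, hr, h⟩ := eq_of_mem_linesMeetingBaseLine hW
    · exact Or.inl h
    · exact Or.inr ⟨r, hr, h.symm⟩
  · rintro (rfl | ⟨r, hr, rfl⟩)
    · exact lineAtInfinity_mem K
    · exact rootLine_mem hr

/-- Over an algebraically closed field of characteristic 2, the line
`ℓ : x₀ = x₁ = 0` lies on the quartic above, and exactly 16 lines on the quartic,
distinct from `ℓ`, have nonempty intersection with `ℓ`.  Lines are 2-dimensional
subspaces of `K⁴`; two lines of ℙ³ meet iff the corresponding subspaces intersect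
nontrivially. -/
theorem exQuartic_line_valency_16 (K : Type*) [Field K] [IsAlgClosed K] [CharP K 2] :
    (∀ v ∈ (Submodule.span K {![0, 0, 1, 0], ![0, 0, 0, 1]} :
        Submodule K (Fin 4 → K)), eval v (exQuartic K) = 0) ∧
    {W : Submodule K (Fin 4 → K) |
        Module.finrank K W = 2 ∧ (∀ v ∈ W, eval v (exQuartic K) = 0) ∧
        W ≠ Submodule.span K {![0, 0, 1, 0], ![0, 0, 0, 1]} ∧
        W ⊓ Submodule.span K {![0, 0, 1, 0], ![0, 0, 0, 1]} ≠ ⊥}.Finite ∧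
    {W : Submodule K (Fin 4 → K) |
        Module.finrank K W = 2 ∧ (∀ v ∈ W, eval v (exQuartic K) = 0) ∧
        W ≠ Submodule.span K {![0, 0, 1, 0], ![0, 0, 0, 1]} ∧
        W ⊓ Submodule.span K {![0, 0, 1, 0], ![0, 0, 0, 1]} ≠ ⊥}.ncard = 16 := by
  have : Infinite K := IsAlgClosed.instInfinite
  refine ⟨fun v hv => ?_, ?_⟩
  · obtain ⟨h0, h1⟩ := mem_baseLine_iff.1 hv
    simp [eval_exQuartic, h0, h1]
  · change (linesMeetingBaseLine K).Finite ∧ (linesMeetingBaseLine K).ncard = 16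
    obtain ⟨hfin, hcard⟩ := ncard_roots_eq_fifteen K
    rw [linesMeetingBaseLine_eq K]
    refine ⟨(hfin.image _).insert _, ?_⟩
    rw [Set.ncard_insert_of_notMem _ (hfin.image _), Set.ncard_image_of_injective _
      rootLine_injective, hcard]
    rintro ⟨r, -, h⟩
    exact lineAtInfinity_ne_rootLine r h.symm
end

section
/- Let K be an algebraically closed field of characteristic 2 and let X ⊂ ℙ³ be the quartic surface defined by x₀³x₁ + x₀x₁³ + x₀x₂³ + x₀²x₁x₃ + x₁x₂²x₃ + x₀²x₃² + x₁²x₃² + x₀x₃³ = 0. Then: (a) the line {x₀ = 0, x₃ = 0} lies on X; (b) every root s ∈ K of the polynomial s¹⁵ + s¹² + s⁹ + s⁸ + s⁷ + s⁶ + s⁴ + s³ + s² + s + 1 satisfies s ≠ 0 and s⁴ + s + 1 ≠ 0, and for every such root s the line cut out by the two linear forms x₁ + s⁴·x₀ and x₀ + (s/(s⁴+s+1))·x₂ + s⁻²·x₃ lies on X and meets the line ℓ : x₀ = x₁ = 0. -/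
open MvPolynomial

/-- The line cut out by the two linear forms `x₁ + s⁴x₀` and
`x₀ + (s/(s⁴+s+1))·x₂ + s⁻²·x₃`, as an intersection of kernels. -/
noncomputable def cutLine (K : Type*) [Field K] (s : K) : Submodule K (Fin 4 → K) :=
  LinearMap.ker ((LinearMap.proj 1 : (Fin 4 → K) →ₗ[K] K)
      + s ^ 4 • (LinearMap.proj 0 : (Fin 4 → K) →ₗ[K] K)) ⊓
  LinearMap.ker ((LinearMap.proj 0 : (Fin 4 → K) →ₗ[K] K)
      + (s / (s ^ 4 + s + 1)) • (LinearMap.proj 2 : (Fin 4 → K) →ₗ[K] K)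
      + (s⁻¹) ^ 2 • (LinearMap.proj 3 : (Fin 4 → K) →ₗ[K] K))

/-- In characteristic 2, the line `cutLine K s` is spanned by `(1, s⁴, 0, s²)` and
`(0, 0, 1, s³/(s⁴+s+1))`. -/
lemma cutLine_eq_span {K : Type*} [Field K] [CharP K 2] {s : K} (hs : s ≠ 0) :
    cutLine K s =
      Submodule.span K {![1, s ^ 4, 0, s ^ 2], ![0, 0, 1, s ^ 3 / (s ^ 4 + s + 1)]} := by
  have h2 : (2 : K) = 0 := CharTwo.two_eq_zero
  ext v
  simp only [cutLine, Submodule.mem_inf, LinearMap.mem_ker, LinearMap.add_apply,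
    LinearMap.smul_apply, LinearMap.proj_apply, smul_eq_mul, Submodule.mem_span_pair, div_eq_mul_inv]
  generalize (s ^ 4 + s + 1)⁻¹ = d
  constructor
  · rintro ⟨h₁, h₃⟩
    field_simp at h₃
    refine ⟨v 0, v 2, ?_⟩
    ext i
    fin_cases i
    · simp
    · simp
      linear_combination v 0 * s ^ 4 * h2 - h₁
    · simp
    · simp
      linear_combination h₃ - v 3 * h2
  · rintro ⟨a, b, rfl⟩
    constructor
    · simp
      linear_combination a * s ^ 4 * h2
    · simp
      field_simp
      linear_combination (a + b * s * d) * h2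

lemma finrank_cutLine {K : Type*} [Field K] [CharP K 2] {s : K} (hs : s ≠ 0) :
    Module.finrank K (cutLine K s) = 2 := by
  have hli : LinearIndependent K
      ![![1, s ^ 4, 0, s ^ 2], ![0, 0, 1, s ^ 3 / (s ^ 4 + s + 1)]] := by
    refine LinearIndependent.pair_iff.2 fun a b hab => ⟨?_, ?_⟩
    · simpa using congrFun hab 0
    · simpa using congrFun hab 2
  have h := finrank_span_eq_card hli
  rw [Matrix.range_cons, Matrix.range_cons, Matrix.range_empty, Set.union_empty,
    Set.singleton_union] at h
  rw [cutLine_eq_span hs, h, Fintype.card_fin]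

/-- (a) The line `{x₀ = 0, x₃ = 0}` lies on the quartic above.
(b) Every root `s` of `s¹⁵+s¹²+s⁹+s⁸+s⁷+s⁶+s⁴+s³+s²+s+1` satisfies `s ≠ 0` and
`s⁴+s+1 ≠ 0`, and the line cut out by `x₁ + s⁴x₀` and `x₀ + (s/(s⁴+s+1))x₂ + s⁻²x₃`
is a line (2-dimensional subspace) lying on the quartic and meeting the line
`ℓ : x₀ = x₁ = 0`. -/
theorem exQuartic_sixteen_lines (K : Type*) [Field K] [IsAlgClosed K] [CharP K 2] :
    (∀ v ∈ (Submodule.span K {![0, 1, 0, 0], ![0, 0, 1, 0]} :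
        Submodule K (Fin 4 → K)), eval v (exQuartic K) = 0) ∧
    (∀ s : K,
      s ^ 15 + s ^ 12 + s ^ 9 + s ^ 8 + s ^ 7 + s ^ 6 + s ^ 4 + s ^ 3 + s ^ 2 + s + 1 = 0 →
      s ≠ 0 ∧ s ^ 4 + s + 1 ≠ 0 ∧
      Module.finrank K (cutLine K s) = 2 ∧
      (∀ v ∈ cutLine K s, eval v (exQuartic K) = 0) ∧
      cutLine K s ⊓ Submodule.span K {![0, 0, 1, 0], ![0, 0, 0, 1]} ≠ ⊥) := by
  have h2 : (2 : K) = 0 := CharTwo.two_eq_zero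
  refine ⟨fun v hv => ?_, fun s hroot => ?_⟩
  · obtain ⟨a, b, rfl⟩ := Submodule.mem_span_pair.1 hv
    simp [exQuartic]
  have hroot' : (s ^ 4 + s + 1) ^ 3 + s ^ 7 * (s ^ 4 + s + 1) ^ 2 + s ^ 9 = 0 := by
    linear_combination hroot +
      (s + s ^ 2 + s ^ 4 + 3 * s ^ 5 + s ^ 6 + 2 * s ^ 8 + 2 * s ^ 9 + s ^ 11 + s ^ 12) * h2
  have hs : s ≠ 0 := by
    rintro rfl
    simp at hroot
  have ht : s ^ 4 + s + 1 ≠ 0 := by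
    intro ht
    simp [ht, hs] at hroot'
  refine ⟨hs, ht, finrank_cutLine hs, fun v hv => ?_, ?_⟩
  · rw [cutLine_eq_span hs] at hv
    obtain ⟨a, b, rfl⟩ := Submodule.mem_span_pair.1 hv
    have hc : s ^ 3 / (s ^ 4 + s + 1) * (s ^ 4 + s + 1) = s ^ 3 := div_mul_cancel₀ _ ht
    generalize s ^ 3 / (s ^ 4 + s + 1) = c at hc ⊢
    have hcube : 1 + s ^ 4 * c + c ^ 3 = 0 := by
      refine (mul_eq_zero.1 ?_).resolve_left (pow_ne_zero 3 ht)
      generalize s ^ 4 + s + 1 = t at hc hroot' ⊢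
      linear_combination hroot' +
        (s ^ 4 * t ^ 2 + (c * t) ^ 2 + c * t * s ^ 3 + s ^ 6) * hc
    simp [exQuartic]
    linear_combination
      (a ^ 4 * (s ^ 4 + s ^ 6 + s ^ 12) + a ^ 3 * b * (2 * s ^ 4 + s ^ 2 + s ^ 10) * c
        + a ^ 2 * b ^ 2 * (s ^ 6 + (s ^ 2 - s ^ 5 - s ^ 4 - s) * c ^ 2)) * h2
      + a ^ 2 * b ^ 2 * (c * (s ^ 4 + s + 1) + s ^ 3) * hc + a * b ^ 3 * hcube
  · refine (Submodule.ne_bot_iff _).2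
      ⟨![0, 0, 1, s ^ 3 / (s ^ 4 + s + 1)], ⟨?_, ?_⟩, fun h => ?_⟩
    · rw [cutLine_eq_span hs]
      exact Submodule.subset_span (by simp)
    · exact Submodule.mem_span_pair.2 ⟨1, s ^ 3 / (s ^ 4 + s + 1), by simp⟩
    · simpa using congrFun h 2
end

section
/- Let K be an algebraically closed field of arbitrary characteristic, F ∈ K[x₀,x₁,x₂,x₃] an irreducible homogeneous polynomial of degree 4, and X = {F = 0} ⊂ ℙ³. Let P ∈ X be a double point of X; that is, after a linear change of coordinates taking P to [0:0:0:1], writing F = c·x₃⁴ + x₃³·f₁ + x₃²·f₂ + x₃·f₃ + f₄ with fᵢ homogeneous of degree i in x₀,x₁,x₂, one has c = 0, f₁ = 0 and f₂ ≠ 0. Then at most 8 lines lying on X pass through P. -/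
open MvPolynomial

lemma eval_aeval_eq {σ τ K : Type*} [CommSemiring K] (x : τ → K) (g : σ → MvPolynomial τ K)
    (f : MvPolynomial σ K) : eval x (aeval g f) = eval (fun i => eval x (g i)) f := by
  rw [← coe_aeval_eq_eval, ← coe_aeval_eq_eval]
  exact congrArg (fun φ : MvPolynomial σ K →ₐ[K] K => φ f) (comp_aeval g (aeval x))

namespace MvPolynomial.IsHomogeneous

variable {σ K : Type*} [Field K]

lemma aeval_const_mul {A : Type*} [CommSemiring A] [Algebra K A] {f : MvPolynomial σ K} {d : ℕ}
    (hf : f.IsHomogeneous d) (c : A) (g : σ → A) :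
    MvPolynomial.aeval (fun i => c * g i) f = c ^ d * MvPolynomial.aeval g f := by
  rw [aeval_def, aeval_def, eval₂_eq, eval₂_eq, Finset.mul_sum]
  refine Finset.sum_congr rfl fun m hm => ?_
  simp_rw [mul_pow]
  rw [Finset.prod_mul_distrib, Finset.prod_pow_eq_pow_sum, ← hf.degree_eq_sum_deg_support hm]
  ring

lemma eval_smul {f : MvPolynomial σ K} {d : ℕ} (hf : f.IsHomogeneous d) (c : K) (x : σ → K) :
    eval (c • x) f = c ^ d * eval x f := by
  rw [← coe_aeval_eq_eval, ← coe_aeval_eq_eval]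
  exact hf.aeval_const_mul c x

lemma irreducible_of_one {L : MvPolynomial σ K}
    (hL : L.IsHomogeneous 1) (h0 : L ≠ 0) : Irreducible L := by
  refine irreducible_of_totalDegree_eq_one (hL.totalDegree h0) fun x hx => ?_
  rw [isUnit_iff_ne_zero]
  rintro rfl
  exact h0 (MvPolynomial.ext _ _ fun i => by simpa using hx i)

/-- The cofactor of a homogeneous factor of a homogeneous polynomial is homogeneous. -/
lemma of_mul_left {L M : MvPolynomial σ K} {m n : ℕ}
    (hL : L.IsHomogeneous m) (h0 : L ≠ 0) (h : (L * M).IsHomogeneous (m + n)) :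
    M.IsHomogeneous n := by
  let _ : GradedAlgebra (homogeneousSubmodule σ K) := gradedAlgebra
  have h1 := DirectSum.coe_decompose_mul_add_of_left_mem (homogeneousSubmodule σ K)
    (a := L) (b := M) (i := m) (j := n) hL
  have h2 := DirectSum.decompose_of_mem_same (homogeneousSubmodule σ K) (x := L * M) h
  rw [h2] at h1
  rw [mul_left_cancel₀ h0 h1]
  exact SetLike.coe_mem (DirectSum.decompose (homogeneousSubmodule σ K) M n)

end MvPolynomial.IsHomogeneous

/-- The linear form `∑ aᵢ Xᵢ` with coefficient vector `a`. -/
noncomputable def linForm {σ K : Type*} [Fintype σ] [CommSemiring K] (a : σ → K) :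
    MvPolynomial σ K :=
  ∑ i, C (a i) * X i

section LinForm

variable {σ K : Type*} [Fintype σ] [Field K]

lemma eval_linForm (a x : σ → K) : eval x (linForm a) = ∑ i, a i * x i := by
  simp [linForm]

lemma isHomogeneous_linForm (a : σ → K) : (linForm a).IsHomogeneous 1 :=
  IsHomogeneous.sum _ _ _ fun i _ => isHomogeneous_C_mul_X (a i) i

lemma linForm_ne_zero {a : σ → K} (ha : a ≠ 0) : linForm a ≠ 0 := by
  classical
  obtain ⟨k, hk⟩ := Function.ne_iff.mp ha
  intro h
  apply hk
  have := congrArg (eval (Pi.single k 1)) h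
  rw [eval_linForm] at this
  simpa [Pi.single_apply] using this

lemma exists_eq_linForm {L : MvPolynomial σ K} (hL : L.IsHomogeneous 1) :
    ∃ a, L = linForm a := by
  have h : L ∈ Submodule.span K (Set.range (X : σ → MvPolynomial σ K)) := by
    rw [← homogeneousSubmodule_one_eq_span_X]
    exact hL
  obtain ⟨a, rfl⟩ := (Submodule.mem_span_range_iff_exists_fun K).mp h
  exact ⟨a, by simp [linForm, smul_eq_C_mul]⟩

/-- A polynomial vanishing on the hyperplane of a nonzero linear form is divisible by it. -/
lemma linForm_dvd [Infinite K] {a : σ → K} (ha : a ≠ 0) {f : MvPolynomial σ K}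
    (h : ∀ x, ∑ i, a i * x i = 0 → eval x f = 0) : linForm a ∣ f := by
  classical
  obtain ⟨k, hk : a k ≠ 0⟩ := Function.ne_iff.mp ha
  let g : σ → MvPolynomial σ K := fun i => X i - C ((Pi.single k (a k)⁻¹ : σ → K) i) * linForm a
  have hg : aeval g f = 0 := by
    apply MvPolynomial.funext
    intro x
    rw [eval_aeval_eq, map_zero]
    apply h
    simp only [g, map_sub, map_mul, eval_X, eval_C, eval_linForm, mul_sub, Finset.sum_sub_distrib]
    rw [sub_eq_zero]
    simp [Pi.single_apply, hk]
  rw [← Ideal.mem_span_singleton, ← Ideal.Quotient.eq_zero_iff_mem]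
  let I := Ideal.span {linForm a}
  have hgi : ∀ i, Ideal.Quotient.mkₐ K I (g i) = Ideal.Quotient.mkₐ K I (X i) := by
    intro i
    rw [Ideal.Quotient.mkₐ_eq_mk, Ideal.Quotient.eq, Ideal.mem_span_singleton]
    exact ⟨-C ((Pi.single k (a k)⁻¹ : σ → K) i), by simp only [g]; ring⟩
  calc Ideal.Quotient.mk I f = Ideal.Quotient.mkₐ K I (aeval X f) := by simp
    _ = Ideal.Quotient.mkₐ K I (aeval g f) := by
      rw [← AlgHom.comp_apply, ← AlgHom.comp_apply, comp_aeval, comp_aeval]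
      simp only [hgi]
    _ = 0 := by rw [hg, map_zero]

end LinForm

/-- A binary form of degree `n` with more than `n` zeros in `ℙ¹` is zero. -/
lemma binaryForm_eq_zero {K : Type*} [Field K] [Infinite K] {ι : Type*} (n : ℕ) :
    ∀ {G : MvPolynomial (Fin 2) K} (_ : G.IsHomogeneous n) (s : Finset ι) (p : ι → Fin 2 → K)
      (_ : ∀ i ∈ s, ∀ j ∈ s, i ≠ j → p i 0 * p j 1 ≠ p i 1 * p j 0)
      (_ : ∀ i ∈ s, eval (p i) G = 0) (_ : n < s.card), G = 0 := by
  classical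
  induction n with
  | zero =>
    intro G hG s p _ hz hs
    obtain ⟨i, hi⟩ := Finset.card_pos.mp hs
    have h := hz i hi
    rw [totalDegree_eq_zero_iff_eq_C.mp (Nat.le_zero.mp hG.totalDegree_le)] at h ⊢
    simpa using h
  | succ n ih =>
    intro G hG s p hp hz hs
    obtain ⟨i, hi, j, hj, hij⟩ := Finset.one_lt_card.mp (show 1 < s.card by omega)
    let a : Fin 2 → K := ![p i 1, -p i 0]
    have hpi : p i 0 ≠ 0 ∨ p i 1 ≠ 0 := by
      by_contra! h
      exact hp i hi j hj hij (by simp [h.1, h.2])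
    have ha : a ≠ 0 := by
      intro h
      have h0 := congrFun h 0
      have h1 := congrFun h 1
      simp [a] at h0 h1
      tauto
    have hdvd : linForm a ∣ G := by
      apply linForm_dvd ha
      intro x hx
      have hx' : p i 1 * x 0 = p i 0 * x 1 := by
        simp [a] at hx
        linear_combination hx
      have : ∃ c : K, x = c • p i := by
        rcases hpi with h | h
        · refine ⟨x 0 / p i 0, funext fun k => ?_⟩
          fin_cases k <;> simp <;> field_simp
          linear_combination -hx'
        · refine ⟨x 1 / p i 1, funext fun k => ?_⟩
          fin_cases k <;> simp <;> field_simp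
          linear_combination hx'
      obtain ⟨c, rfl⟩ := this
      rw [hG.eval_smul, hz i hi, mul_zero]
    obtain ⟨M, rfl⟩ := hdvd
    have hM : M.IsHomogeneous n :=
      (isHomogeneous_linForm a).of_mul_left (linForm_ne_zero ha) (by rwa [add_comm 1 n])
    have : M = 0 := by
      apply ih hM (s.erase i) p
      · intro k hk l hl
        exact hp k (Finset.mem_of_mem_erase hk) l (Finset.mem_of_mem_erase hl)
      · intro k hk
        have h := hz k (Finset.mem_of_mem_erase hk)
        rw [map_mul, mul_eq_zero] at h
        refine h.resolve_left fun h' => ?_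
        apply hp i hi k (Finset.mem_of_mem_erase hk) (Finset.ne_of_mem_erase hk).symm
        simp [eval_linForm, a] at h'
        linear_combination -h'
      · rw [Finset.card_erase_of_mem hi]
        omega
    rw [this, mul_zero]

section LinSubst

variable {n K : Type*} [Fintype n] [Field K]

/-- The linear substitution `Xᵢ ↦ ∑ⱼ Aᵢⱼ Xⱼ`. -/
noncomputable def linSubst (A : Matrix n n K) : MvPolynomial n K →ₐ[K] MvPolynomial n K :=
  bind₁ fun i => ∑ j, C (A i j) * X j

lemma eval_linSubst (A : Matrix n n K) (x : n → K) (f : MvPolynomial n K) :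
    eval x (linSubst A f) = eval (A.mulVec x) f := by
  refine (eval_aeval_eq x _ f).trans ?_
  congr 2
  ext i
  simp [Matrix.mulVec, dotProduct]

lemma MvPolynomial.IsHomogeneous.linSubst {f : MvPolynomial n K} {d : ℕ} (hf : f.IsHomogeneous d)
    (A : Matrix n n K) : (linSubst A f).IsHomogeneous d := by
  have := hf.aeval (fun i => linForm (A i)) fun i => isHomogeneous_linForm (A i)
  rwa [one_mul] at this

variable [DecidableEq n] [Infinite K]

lemma linSubst_linSubst {A B : Matrix n n K} (h : B * A = 1) (f : MvPolynomial n K) :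
    linSubst A (linSubst B f) = f := by
  apply MvPolynomial.funext
  intro x
  rw [eval_linSubst, eval_linSubst, Matrix.mulVec_mulVec, h, Matrix.one_mulVec]

/-- Invertible linear substitutions as automorphisms of the polynomial ring. -/
noncomputable def linSubstEquiv (A : Matrix n n K) (hA : IsUnit A.det) :
    MvPolynomial n K ≃ₐ[K] MvPolynomial n K :=
  AlgEquiv.ofAlgHom (linSubst A) (linSubst A⁻¹)
    (AlgHom.ext fun f => linSubst_linSubst (Matrix.nonsing_inv_mul _ hA) f)
    (AlgHom.ext fun f => linSubst_linSubst (Matrix.mul_nonsing_inv _ hA) f)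

lemma linSubstEquiv_apply (A : Matrix n n K) (hA : IsUnit A.det) (f : MvPolynomial n K) :
    linSubstEquiv A hA f = linSubst A f := rfl

end LinSubst

/-- A ternary quadratic form vanishing at `[1:0:0]` is linear in the first variable. -/
lemma exists_eq_pencil {K : Type*} [Field K] {q : MvPolynomial (Fin 3) K} (hq : q.IsHomogeneous 2)
    (h0 : eval ![1, 0, 0] q = 0) :
    ∃ l m : MvPolynomial (Fin 2) K, l.IsHomogeneous 1 ∧ m.IsHomogeneous 2 ∧
      q = rename Fin.succ l * X 0 + rename Fin.succ m := by
  set Q := finSuccEquiv K 2 q with hQ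
  have hdeg : Q.degree ≤ 2 := by
    refine Polynomial.degree_le_of_natDegree_le ?_
    rw [natDegree_finSuccEquiv]
    exact (degreeOf_le_totalDegree _ _).trans hq.totalDegree_le
  have hl : (Q.coeff 1).IsHomogeneous 1 := hq.finSuccEquiv_coeff_isHomogeneous 1 1 rfl
  have hm : (Q.coeff 0).IsHomogeneous 2 := hq.finSuccEquiv_coeff_isHomogeneous 0 2 rfl
  have hc : (Q.coeff 2).IsHomogeneous 0 := hq.finSuccEquiv_coeff_isHomogeneous 2 0 rfl
  have hren : ∀ r : MvPolynomial (Fin 2) K,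
      finSuccEquiv K 2 (rename Fin.succ r) = Polynomial.C r := by
    intro r
    induction r using MvPolynomial.induction_on with
    | C a => simp [finSuccEquiv_apply]
    | add a b ha hb => simp [ha, hb]
    | mul_X a i ha => rw [map_mul, map_mul, ha, rename_X, finSuccEquiv_X_succ, map_mul]
  have hq' : q = rename Fin.succ (Q.coeff 2) * X 0 ^ 2 + rename Fin.succ (Q.coeff 1) * X 0 +
      rename Fin.succ (Q.coeff 0) := by
    apply (finSuccEquiv K 2).injective
    simp only [map_add, map_mul, map_pow, hren, finSuccEquiv_X_zero]
    exact Polynomial.eq_quadratic_of_degree_le_two hdeg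
  have hc0 : Q.coeff 2 = 0 := by
    rw [totalDegree_eq_zero_iff_eq_C.mp (Nat.le_zero.mp hc.totalDegree_le)] at hq' ⊢
    have h00 : (![1, 0, 0] : Fin 3 → K) ∘ Fin.succ = 0 := by
      ext k
      fin_cases k <;> rfl
    have hl0 : eval 0 (Q.coeff 1) = 0 := by
      rw [← zero_smul K (0 : Fin 2 → K), hl.eval_smul, zero_pow one_ne_zero, zero_mul]
    have hm0 : eval 0 (Q.coeff 0) = 0 := by
      rw [← zero_smul K (0 : Fin 2 → K), hm.eval_smul, zero_pow two_ne_zero, zero_mul]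
    rw [hq'] at h0
    simp only [map_add, map_mul, eval_rename, h00, hl0, hm0, rename_C, eval_C, map_pow, eval_X]
      at h0
    simpa using h0
  refine ⟨Q.coeff 1, Q.coeff 0, hl, hm, ?_⟩
  rw [hc0] at hq'
  simpa using hq'

section PlaneCurves

variable {K : Type*} [Field K] [Infinite K] {ι : Type*}

/-- A plane curve of degree `d` not containing a given line meets it in at most `d` points. -/
lemma card_le_of_not_linForm_dvd {a : Fin 3 → K} (ha : a ≠ 0) {f : MvPolynomial (Fin 3) K} {d : ℕ}
    (hf : f.IsHomogeneous d) (hndvd : ¬ linForm a ∣ f) (s : Finset ι) (p : ι → Fin 3 → K)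
    (hp : ∀ i ∈ s, ∀ j ∈ s, i ≠ j → LinearIndependent K ![p i, p j])
    (hL : ∀ i ∈ s, eval (p i) (linForm a) = 0) (hz : ∀ i ∈ s, eval (p i) f = 0) :
    s.card ≤ d := by
  by_contra! hcard
  apply hndvd
  have hspan : ∃ u w : Fin 3 → K, ∀ x, ∑ i, a i * x i = 0 → ∃ b c : K, x = b • u + c • w := by
    obtain ⟨k, hk⟩ := Function.ne_iff.mp ha
    simp only [Fin.sum_univ_three]
    fin_cases k <;> simp at hk
    · refine ⟨![-a 1 / a 0, 1, 0], ![-a 2 / a 0, 0, 1], fun x hx => ⟨x 1, x 2, ?_⟩⟩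
      ext i
      fin_cases i <;> simp
      field_simp
      linear_combination hx
    · refine ⟨![1, -a 0 / a 1, 0], ![0, -a 2 / a 1, 1], fun x hx => ⟨x 0, x 2, ?_⟩⟩
      ext i
      fin_cases i <;> simp
      field_simp
      linear_combination hx
    · refine ⟨![1, 0, -a 0 / a 2], ![0, 1, -a 1 / a 2], fun x hx => ⟨x 0, x 1, ?_⟩⟩
      ext i
      fin_cases i <;> simp
      field_simp
      linear_combination hx
  obtain ⟨u, w, huw⟩ := hspan
  let g : Fin 3 → MvPolynomial (Fin 2) K := fun k => C (u k) * X 0 + C (w k) * X 1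
  have heval : ∀ b c : K, eval ![b, c] (aeval g f) = eval (b • u + c • w) f := by
    intro b c
    rw [eval_aeval_eq]
    congr 2
    ext k
    simp [g, mul_comm]
  have hpt : ∀ i ∈ s, ∃ y : K × K, p i = y.1 • u + y.2 • w := by
    intro i hi
    obtain ⟨b, c, h⟩ := huw (p i) (by rw [← eval_linForm]; exact hL i hi)
    exact ⟨(b, c), h⟩
  choose! y hy using hpt
  have hG : aeval g f = 0 := by
    refine binaryForm_eq_zero (1 * d)
      (hf.aeval g fun k => (isHomogeneous_C_mul_X _ _).add (isHomogeneous_C_mul_X _ _)) s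
      (fun i => ![(y i).1, (y i).2]) ?_ ?_ (by omega)
    · intro i hi j hj hij hdet
      simp at hdet
      have hli := LinearIndependent.pair_iff.mp (hp i hi j hj hij)
      have h1 := hli (y j).1 (-(y i).1) (by
        rw [hy i hi, hy j hj]
        ext k
        simp
        linear_combination (-w k) * hdet)
      have h2 := hli (y j).2 (-(y i).2) (by
        rw [hy i hi, hy j hj]
        ext k
        simp
        linear_combination (u k) * hdet)
      have h3 := hli 1 0 (by
        rw [hy i hi, neg_eq_zero.mp h1.2, neg_eq_zero.mp h2.2]
        simp)
      exact one_ne_zero h3.1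
    · intro i hi
      rw [heval, ← hy i hi, hz i hi]
  apply linForm_dvd ha
  intro x hx
  obtain ⟨b, c, rfl⟩ := huw x hx
  rw [← heval, hG, map_zero]

/-- Let `l X₀ + m` be a conic through `[1:0:0]` without linear factors. A curve of degree `d`
meeting it in more than `2 d` points, one of them `[1:0:0]`, contains it. -/
lemma conic_dvd_of_pencil {l m : MvPolynomial (Fin 2) K} (hl : l.IsHomogeneous 1)
    (hm : m.IsHomogeneous 2) {q : MvPolynomial (Fin 3) K}
    (hq : q = rename Fin.succ l * X 0 + rename Fin.succ m)
    (hlin : ∀ L : MvPolynomial (Fin 3) K, L.IsHomogeneous 1 → L ≠ 0 → ¬ L ∣ q)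
    {f : MvPolynomial (Fin 3) K} {d : ℕ} (hf : f.IsHomogeneous d)
    (s : Finset ι) (p : ι → Fin 3 → K)
    (hp : ∀ i ∈ s, ∀ j ∈ s, i ≠ j → LinearIndependent K ![p i, p j])
    (hzq : ∀ i ∈ s, eval (p i) q = 0) (hzf : ∀ i ∈ s, eval (p i) f = 0)
    {o : ι} (ho : o ∈ s) (hpo : p o = ![1, 0, 0]) (hcard : 2 * d < s.card) (hs : 1 < s.card) :
    q ∣ f := by
  classical
  have hevq : ∀ x : Fin 3 → K, eval x q = eval ![x 1, x 2] l * x 0 + eval ![x 1, x 2] m := by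
    intro x
    have : x ∘ Fin.succ = ![x 1, x 2] := by
      ext k
      fin_cases k <;> rfl
    simp [hq, eval_rename, this]
  have hl0 : ∀ x : Fin 3 → K, eval x q = 0 → (x 1 ≠ 0 ∨ x 2 ≠ 0) → eval ![x 1, x 2] l ≠ 0 := by
    intro x hx hx0 hlx
    have hmx : eval ![x 1, x 2] m = 0 := by
      simpa [hevq, hlx] using hx
    have ha : (![0, x 2, -x 1] : Fin 3 → K) ≠ 0 := by
      intro h
      have h1 := congrFun h 1
      have h2 := congrFun h 2
      simp at h1 h2
      tauto
    refine hlin _ (isHomogeneous_linForm _) (linForm_ne_zero ha) (linForm_dvd ha fun z hz => ?_)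
    have hz' : x 2 * z 1 = x 1 * z 2 := by
      simp [Fin.sum_univ_three] at hz
      linear_combination hz
    have : ∃ c : K, ![z 1, z 2] = c • ![x 1, x 2] := by
      rcases hx0 with h | h
      · refine ⟨z 1 / x 1, funext fun k => ?_⟩
        fin_cases k <;> simp <;> field_simp
        linear_combination -hz'
      · refine ⟨z 2 / x 2, funext fun k => ?_⟩
        fin_cases k <;> simp <;> field_simp
        linear_combination hz'
    obtain ⟨c, hc⟩ := this
    rw [hevq, hc, hl.eval_smul, hm.eval_smul, hlx, hmx]
    simp
  have hoff : ∀ i ∈ s, i ≠ o → p i 1 ≠ 0 ∨ p i 2 ≠ 0 := by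
    intro i hi hio
    by_contra! h
    have := (LinearIndependent.pair_iff.mp (hp i hi o ho hio)) 1 (-p i 0) (by
      rw [hpo]
      ext k
      fin_cases k <;> simp [h.1, h.2])
    exact one_ne_zero this.1
  have hlne : l ≠ 0 := by
    obtain ⟨i, hi, hio⟩ := Finset.exists_mem_ne hs o
    rintro rfl
    exact hl0 (p i) (hzq i hi) (hoff i hi hio) (map_zero _)
  obtain ⟨a, rfl⟩ := exists_eq_linForm hl
  have ha : a ≠ 0 := by
    rintro rfl
    exact hlne (by simp [linForm])
  let g : Fin 3 → MvPolynomial (Fin 2) K := Fin.cons (-m) fun k => linForm a * X k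
  have hg : ∀ k, (g k).IsHomogeneous 2 := by
    intro k
    refine Fin.cases ?_ (fun k => ?_) k
    · exact hm.neg
    · exact hl.mul (isHomogeneous_X _ _)
  have hevg : ∀ b : Fin 2 → K, eval b (aeval g f) =
      eval ![-eval b m, eval b (linForm a) * b 0, eval b (linForm a) * b 1] f := by
    intro b
    rw [eval_aeval_eq]
    congr 2
    ext k
    fin_cases k
    · simp [g]
    · exact (by simp : eval b (linForm a * X 0) = eval b (linForm a) * b 0)
    · exact (by simp : eval b (linForm a * X 1) = eval b (linForm a) * b 1)
  have hG : aeval g f = 0 := by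
    refine binaryForm_eq_zero (2 * d) (hf.aeval g hg) s
      (fun i => if i = o then ![-a 1, a 0] else ![p i 1, p i 2]) ?_ ?_ hcard
    · intro i hi j hj hij
      by_cases hio : i = o
      · have hjo : j ≠ o := fun h => hij (hio.trans h.symm)
        have := hl0 (p j) (hzq j hj) (hoff j hj hjo)
        simp [hio, hjo, eval_linForm] at this ⊢
        intro h
        apply this
        linear_combination -h
      · by_cases hjo : j = o
        · have := hl0 (p i) (hzq i hi) (hoff i hi hio)
          simp [hio, hjo, eval_linForm] at this ⊢
          intro h
          apply this
          linear_combination h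
        · simp only [hio, hjo, if_false]
          intro hdet
          simp at hdet
          have hli := LinearIndependent.pair_iff.mp (hp i hi j hj hij)
          have hqi := hzq i hi
          have hqj := hzq j hj
          have hlj := hl0 (p j) (hzq j hj) (hoff j hj hjo)
          have hli' := hl0 (p i) (hzq i hi) (hoff i hi hio)
          obtain ⟨c, hc⟩ : ∃ c : K, ![p j 1, p j 2] = c • ![p i 1, p i 2] := by
            rcases hoff i hi hio with h | h
            · refine ⟨p j 1 / p i 1, funext fun k => ?_⟩
              fin_cases k <;> simp <;> field_simp
              linear_combination hdet
            · refine ⟨p j 2 / p i 2, funext fun k => ?_⟩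
              fin_cases k <;> simp <;> field_simp
              linear_combination -hdet
          rw [hevq] at hqi hqj
          rw [hc, hl.eval_smul] at hlj
          rw [hc, hl.eval_smul, hm.eval_smul] at hqj
          have hc1 : p j 1 = c * p i 1 := by simpa using congrFun hc 0
          have hc2 : p j 2 = c * p i 2 := by simpa using congrFun hc 1
          have hc0 : c ≠ 0 := by
            rintro rfl
            simp at hlj
          have hc3 : p j 0 = c * p i 0 := by
            apply mul_left_cancel₀ (mul_ne_zero hc0 hli')
            linear_combination hqj - c ^ 2 * hqi
          have := hli c (-1) (by
            ext k
            fin_cases k <;> simp [hc1, hc2, hc3])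
          exact hc0 this.1
    · intro i hi
      rw [hevg]
      by_cases hio : i = o
      · have h0 : eval ![-a 1, a 0] (linForm a) = 0 := by
          simp [eval_linForm]
          ring
        have hv : ![-eval ![-a 1, a 0] m, 0, 0] = (-eval ![-a 1, a 0] m) • p o := by
          rw [hpo]
          ext k
          fin_cases k <;> simp
        simp only [hio, if_true, h0, zero_mul]
        rw [hv, hf.eval_smul, hzf o ho, mul_zero]
      · simp only [hio, if_false]
        have hqi := hzq i hi
        rw [hevq] at hqi
        have hv : ![-eval ![p i 1, p i 2] m, eval ![p i 1, p i 2] (linForm a) * p i 1,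
            eval ![p i 1, p i 2] (linForm a) * p i 2] =
            eval ![p i 1, p i 2] (linForm a) • p i := by
          ext k
          fin_cases k <;> simp
          linear_combination -hqi
        simp only [Matrix.cons_val_zero, Matrix.cons_val_one]
        rw [hv, hf.eval_smul, hzf i hi, mul_zero]
  set L : MvPolynomial (Fin 3) K := rename Fin.succ (linForm a) with hLdef
  have hL : L.IsHomogeneous 1 := hl.rename_isHomogeneous
  have hL0 : L ≠ 0 := by
    rw [hLdef, Ne, map_eq_zero_iff _ (rename_injective _ (Fin.succ_injective 2))]
    exact hlne
  have hrel : IsRelPrime q (L ^ d) :=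
    (((hL.irreducible_of_one hL0).isRelPrime_iff_not_dvd.mpr (hlin L hL hL0)).symm).pow_right
  refine hrel.dvd_of_dvd_mul_left ?_
  rw [← Ideal.mem_span_singleton, ← Ideal.Quotient.eq_zero_iff_mem]
  let I := Ideal.span {q}
  have hgi : ∀ k, Ideal.Quotient.mkₐ K I (L * X k) =
      Ideal.Quotient.mkₐ K I (rename Fin.succ (g k)) := by
    intro k
    rw [Ideal.Quotient.mkₐ_eq_mk, Ideal.Quotient.eq, Ideal.mem_span_singleton]
    refine Fin.cases ?_ (fun k => ?_) k
    · exact ⟨1, by simp [g, hq]⟩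
    · exact ⟨0, by simp [g, hLdef]⟩
  have hLf : L ^ d * f = aeval (fun k => L * X k) f := by
    rw [hf.aeval_const_mul, aeval_X_left_apply]
  calc Ideal.Quotient.mk I (L ^ d * f)
      = Ideal.Quotient.mkₐ K I (aeval (fun k => L * X k) f) := by
        rw [hLf, Ideal.Quotient.mkₐ_eq_mk]
    _ = Ideal.Quotient.mkₐ K I (rename Fin.succ (aeval g f)) := by
      rw [← AlgHom.comp_apply, ← AlgHom.comp_apply, ← AlgHom.comp_apply, comp_aeval, comp_aeval]
      simp only [hgi, AlgHom.comp_apply]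
    _ = 0 := by rw [hG, map_zero, map_zero]

/-- A curve of degree `d` meeting a conic without linear factors in more than `2 d` points
contains it. -/
lemma conic_dvd {q : MvPolynomial (Fin 3) K} (hq : q.IsHomogeneous 2)
    (hlin : ∀ L : MvPolynomial (Fin 3) K, L.IsHomogeneous 1 → L ≠ 0 → ¬ L ∣ q)
    {f : MvPolynomial (Fin 3) K} {d : ℕ} (hf : f.IsHomogeneous d)
    (s : Finset ι) (p : ι → Fin 3 → K)
    (hp : ∀ i ∈ s, ∀ j ∈ s, i ≠ j → LinearIndependent K ![p i, p j])
    (hzq : ∀ i ∈ s, eval (p i) q = 0) (hzf : ∀ i ∈ s, eval (p i) f = 0)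
    (hcard : 2 * d < s.card) (hs : 1 < s.card) : q ∣ f := by
  obtain ⟨o, ho, j, hj, hoj⟩ := Finset.one_lt_card.mp hs
  have hpo : p o ≠ 0 := (hp o ho j hj hoj).ne_zero 0
  obtain ⟨B, hB, hBo⟩ : ∃ B : Matrix (Fin 3) (Fin 3) K, IsUnit B.det ∧
      B.mulVec ![1, 0, 0] = p o := by
    obtain ⟨k, hk⟩ := Function.ne_iff.mp hpo
    fin_cases k <;> simp at hk
    · refine ⟨!![p o 0, 0, 0; p o 1, 1, 0; p o 2, 0, 1], ?_, ?_⟩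
      · simpa [Matrix.det_fin_three] using hk
      · ext i
        fin_cases i <;> simp [Matrix.mulVec, dotProduct, Fin.sum_univ_three]
    · refine ⟨!![p o 0, 1, 0; p o 1, 0, 0; p o 2, 0, 1], ?_, ?_⟩
      · simpa [Matrix.det_fin_three] using hk
      · ext i
        fin_cases i <;> simp [Matrix.mulVec, dotProduct, Fin.sum_univ_three]
    · refine ⟨!![p o 0, 1, 0; p o 1, 0, 1; p o 2, 0, 0], ?_, ?_⟩
      · simpa [Matrix.det_fin_three] using hk
      · ext i
        fin_cases i <;> simp [Matrix.mulVec, dotProduct, Fin.sum_univ_three]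
  have hBp : ∀ x, B.mulVec (B⁻¹.mulVec x) = x := fun x => by
    rw [Matrix.mulVec_mulVec, Matrix.mul_nonsing_inv _ hB, Matrix.one_mulVec]
  have hBo' : B⁻¹.mulVec (p o) = ![1, 0, 0] := by
    rw [← hBo, Matrix.mulVec_mulVec, Matrix.nonsing_inv_mul _ hB, Matrix.one_mulVec]
  have hev : ∀ (x : Fin 3 → K) (h : MvPolynomial (Fin 3) K),
      eval (B⁻¹.mulVec x) (linSubstEquiv B hB h) = eval x h := fun x h => by
    rw [linSubstEquiv_apply, eval_linSubst, hBp]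
  have hq' : (linSubstEquiv B hB q).IsHomogeneous 2 := hq.linSubst B
  obtain ⟨l, m, hl, hm, hlm⟩ := exists_eq_pencil hq' (by
    rw [← hBo', hev, hzq o ho])
  refine (map_dvd_iff (linSubstEquiv B hB)).mp ?_
  refine conic_dvd_of_pencil hl hm hlm ?_ (hf.linSubst B) s (fun i => B⁻¹.mulVec (p i)) ?_ ?_ ?_
    ho hBo' hcard hs
  · intro L hL hL0 hdvd
    refine hlin (linSubst B⁻¹ L) (hL.linSubst _) ?_ ?_
    · intro h
      exact hL0 ((map_eq_zero_iff (linSubstEquiv B hB).symm (AlgEquiv.injective _)).mp h)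
    · have := map_dvd (linSubstEquiv B hB).symm hdvd
      rwa [AlgEquiv.symm_apply_apply] at this
  · intro i hi j hj hij
    have := (hp i hi j hj hij).map' (Matrix.mulVecLin B⁻¹) (by
      rw [LinearMap.ker_eq_bot']
      intro x hx
      rw [← hBp x, ← Matrix.mulVecLin_apply B⁻¹, hx, Matrix.mulVec_zero])
    have hcomp : ⇑B⁻¹.mulVecLin ∘ ![p i, p j] = ![B⁻¹.mulVec (p i), B⁻¹.mulVec (p j)] := by
      ext k : 1
      fin_cases k <;> rfl
    rwa [hcomp] at this
  · exact fun i hi => (hev _ _).trans (hzq i hi)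
  · exact fun i hi => (hev _ _).trans (hzf i hi)

/-- A conic, a cubic and a quartic without common component meet in at most 8 points. -/
lemma card_le_eight {q f g : MvPolynomial (Fin 3) K} (hq : q.IsHomogeneous 2) (hq0 : q ≠ 0)
    (hf : f.IsHomogeneous 3) (hg : g.IsHomogeneous 4)
    (hcop : ∀ d, d ∣ q → d ∣ f → d ∣ g → IsUnit d) (s : Finset ι) (p : ι → Fin 3 → K)
    (hp : ∀ i ∈ s, ∀ j ∈ s, i ≠ j → LinearIndependent K ![p i, p j])
    (hzq : ∀ i ∈ s, eval (p i) q = 0) (hzf : ∀ i ∈ s, eval (p i) f = 0)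
    (hzg : ∀ i ∈ s, eval (p i) g = 0) : s.card ≤ 8 := by
  classical
  by_cases hlin : ∀ L : MvPolynomial (Fin 3) K, L.IsHomogeneous 1 → L ≠ 0 → ¬ L ∣ q
  · by_contra! hcard
    have hu := hcop q dvd_rfl
      (conic_dvd hq hlin hf s p hp hzq hzf (by omega) (by omega))
      (conic_dvd hq hlin hg s p hp hzq hzg (by omega) (by omega))
    have := (isUnit_iff_totalDegree_of_isReduced.mp hu).2
    rw [hq.totalDegree hq0] at this
    omega
  · push Not at hlin
    obtain ⟨L, hL, hL0, M, rfl⟩ := hlin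
    have hM : M.IsHomogeneous 1 := hL.of_mul_left hL0 hq
    have hM0 : M ≠ 0 := right_ne_zero_of_mul hq0
    have key : ∀ N : MvPolynomial (Fin 3) K, N.IsHomogeneous 1 → N ≠ 0 → N ∣ L * M →
        (s.filter fun i => eval (p i) N = 0).card ≤ 4 := by
      intro N hN hN0 hdvd
      have hnd : ¬ N ∣ f ∨ ¬ N ∣ g := by
        by_contra! h
        exact (hN.irreducible_of_one hN0).not_isUnit (hcop N hdvd h.1 h.2)
      obtain ⟨a, rfl⟩ := exists_eq_linForm hN
      have ha : a ≠ 0 := by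
        rintro rfl
        exact hN0 (by simp [linForm])
      have hsub : ∀ i ∈ s.filter (fun i => eval (p i) (linForm a) = 0), i ∈ s :=
        fun i hi => (Finset.mem_filter.mp hi).1
      have hzN : ∀ i ∈ s.filter (fun i => eval (p i) (linForm a) = 0),
          eval (p i) (linForm a) = 0 := fun i hi => (Finset.mem_filter.mp hi).2
      have hp' : ∀ i ∈ s.filter (fun i => eval (p i) (linForm a) = 0),
          ∀ j ∈ s.filter (fun i => eval (p i) (linForm a) = 0), i ≠ j →
          LinearIndependent K ![p i, p j] := fun i hi j hj => hp i (hsub i hi) j (hsub j hj)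
      rcases hnd with h | h
      · exact (card_le_of_not_linForm_dvd ha hf h _ p hp' hzN
          fun i hi => hzf i (hsub i hi)).trans (by norm_num)
      · exact card_le_of_not_linForm_dvd ha hg h _ p hp' hzN fun i hi => hzg i (hsub i hi)
    have hcover : s ⊆ (s.filter fun i => eval (p i) L = 0) ∪
        (s.filter fun i => eval (p i) M = 0) := by
      intro i hi
      have := hzq i hi
      rw [map_mul, mul_eq_zero] at this
      simpa [hi] using this
    have h1 := Finset.card_le_card hcover
    have h2 := Finset.card_union_le (s.filter fun i => eval (p i) L = 0)
      (s.filter fun i => eval (p i) M = 0)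
    have h3 := key L hL hL0 (dvd_mul_right _ _)
    have h4 := key M hM hM0 (dvd_mul_left _ _)
    omega

end PlaneCurves

section Quartic

variable {K : Type*} [Field K]

/-- A polynomial in which the last variable does not occur comes from the smaller ring. -/
lemma exists_rename_castSucc {n : ℕ} {f : MvPolynomial (Fin (n + 1)) K} {d : ℕ}
    (hf : f.IsHomogeneous d) (h : ∀ m ∈ f.support, m (Fin.last n) = 0) :
    ∃ g : MvPolynomial (Fin n) K, g.IsHomogeneous d ∧ rename Fin.castSucc g = f := by
  obtain ⟨g, hg⟩ := exists_rename_eq_of_vars_subset_range f Fin.castSucc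
    (Fin.castSucc_injective n) (by
      intro i hi
      obtain ⟨m, hm, him⟩ := (mem_vars_iff_mem_support i).mp hi
      refine Fin.exists_castSucc_eq.mpr ?_
      rintro rfl
      exact (Finsupp.mem_support_iff.mp him) (h m hm))
  refine ⟨g, ?_, hg⟩
  rwa [← IsHomogeneous.rename_isHomogeneous_iff (Fin.castSucc_injective n), hg]

/-- The quadratic, cubic and quartic terms of an irreducible quartic at a double point have no
common factor. -/
lemma isUnit_of_dvd_of_irreducible {q f g : MvPolynomial (Fin 3) K} (hq : q.IsHomogeneous 2)
    (hq0 : q ≠ 0)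
    (hG : (X 3 ^ 2 * rename Fin.castSucc q + X 3 * rename Fin.castSucc f +
      rename Fin.castSucc g : MvPolynomial (Fin 4) K).IsHomogeneous 4)
    (hirr : Irreducible (X 3 ^ 2 * rename Fin.castSucc q + X 3 * rename Fin.castSucc f +
      rename Fin.castSucc g : MvPolynomial (Fin 4) K))
    (d : MvPolynomial (Fin 3) K) (hdq : d ∣ q) (hdf : d ∣ f) (hdg : d ∣ g) : IsUnit d := by
  have hinj : Function.Injective (Fin.castSucc : Fin 3 → Fin 4) := Fin.castSucc_injective 3
  have hmap : ∀ r, d ∣ r → rename (Fin.castSucc : Fin 3 → Fin 4) d ∣ rename Fin.castSucc r :=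
    fun r hr => map_dvd _ hr
  have hdvd := dvd_add (dvd_add (Dvd.dvd.mul_left (hmap q hdq) (X 3 ^ 2))
    (Dvd.dvd.mul_left (hmap f hdf) (X 3))) (hmap g hdg)
  obtain ⟨h, hh⟩ := hdvd
  rcases hirr.isUnit_or_isUnit hh with hu | hu
  · simpa [killCompl_rename_app] using hu.map (killCompl (R := K) hinj)
  · exfalso
    have h4 := hG.totalDegree hirr.ne_zero
    have hne := hirr.ne_zero
    rw [hh] at h4 hne
    rw [totalDegree_mul_of_isDomain (left_ne_zero_of_mul hne) (right_ne_zero_of_mul hne),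
      (isUnit_iff_totalDegree_of_isReduced.mp hu).2] at h4
    have hrq0 : rename (Fin.castSucc : Fin 3 → Fin 4) q ≠ 0 := by
      rwa [Ne, map_eq_zero_iff _ (rename_injective _ hinj)]
    have h2 := (hq.rename_isHomogeneous (f := (Fin.castSucc : Fin 3 → Fin 4))).totalDegree hrq0
    obtain ⟨k, hk⟩ := hmap q hdq
    rw [hk] at h2 hrq0
    rw [totalDegree_mul_of_isDomain (left_ne_zero_of_mul hrq0) (right_ne_zero_of_mul hrq0)] at h2
    omega

/-- A plane containing `A e₃` is spanned by `A e₃` and a vector of the form `A (x, 0)`. -/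
lemma exists_span_pair_eq {A : Matrix (Fin 4) (Fin 4) K} (hA : IsUnit A.det)
    {W : Submodule K (Fin 4 → K)} (hW : Module.finrank K W = 2)
    (hv : A.mulVec (Pi.single 3 1) ∈ W) :
    ∃ x : Fin 3 → K, x ≠ 0 ∧
      W = Submodule.span K {A.mulVec (Pi.single 3 1), A.mulVec ![x 0, x 1, x 2, 0]} := by
  obtain ⟨w, hw, hwv⟩ : ∃ w ∈ W, w ∉ Submodule.span K {A.mulVec (Pi.single 3 1)} := by
    by_contra! h
    have h1 := Submodule.finrank_mono (show W ≤ _ from h)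
    have h2 := finrank_span_le_card (R := K) ({A.mulVec (Pi.single 3 1)} : Set (Fin 4 → K))
    simp at h2
    omega
  obtain ⟨y, rfl⟩ : ∃ y, A.mulVec y = w :=
    ⟨A⁻¹.mulVec w, by rw [Matrix.mulVec_mulVec, Matrix.mul_nonsing_inv _ hA, Matrix.one_mulVec]⟩
  have hy : A.mulVec y = A.mulVec ![y 0, y 1, y 2, 0] + y 3 • A.mulVec (Pi.single 3 1) := by
    rw [← Matrix.mulVec_smul, ← Matrix.mulVec_add]
    congr 1
    ext k
    fin_cases k <;> simp
  set v := A.mulVec (Pi.single 3 1) with hvdef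
  set u := A.mulVec ![y 0, y 1, y 2, 0] with hudef
  have huv : u ∉ Submodule.span K {v} := fun h =>
    hwv (hy ▸ add_mem h (Submodule.smul_mem _ _ (Submodule.mem_span_singleton_self v)))
  have huW : u ∈ W := by
    rw [eq_sub_of_add_eq hy.symm]
    exact sub_mem hw (W.smul_mem _ hv)
  have hv0 : v ≠ 0 := by
    intro h
    have h1 : A⁻¹.mulVec v = Pi.single 3 1 := by
      rw [hvdef, Matrix.mulVec_mulVec, Matrix.nonsing_inv_mul _ hA, Matrix.one_mulVec]
    rw [h, Matrix.mulVec_zero] at h1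
    simpa using congrFun h1 3
  have hli : LinearIndependent K ![v, u] := by
    rw [LinearIndependent.pair_iff' hv0]
    intro c hc
    exact huv (hc ▸ Submodule.smul_mem _ _ (Submodule.mem_span_singleton_self v))
  refine ⟨![y 0, y 1, y 2], ?_, ?_⟩
  · intro h
    have h0 : y 0 = 0 := congrFun h 0
    have h1 : y 1 = 0 := congrFun h 1
    have h2 : y 2 = 0 := congrFun h 2
    apply huv
    have : u = 0 := by
      rw [hudef, h0, h1, h2]
      convert Matrix.mulVec_zero A
      ext k
      fin_cases k <;> rfl
    rw [this]
    exact zero_mem _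
  · symm
    apply Submodule.eq_of_le_of_finrank_eq
    · rw [Submodule.span_le]
      rintro z (rfl | rfl)
      · exact hv
      · exact huW
    · have := finrank_span_eq_card hli
      rw [Matrix.range_cons_cons_empty, Fintype.card_fin] at this
      exact this.trans hW.symm

end Quartic

/-- Let `F` be an irreducible quartic form over an algebraically
closed field and `X = {F = 0} ⊂ ℙ³`.  If `P` (represented by the nonzero vector `v`)
is a double point of `X` — i.e. after an invertible linear change of coordinates
taking `[0:0:0:1]` to `P`, the transformed polynomial has the shape
`x₃²·f₂ + x₃·f₃ + f₄` with `fᵢ` homogeneous of degree `i` in `x₀,x₁,x₂` and `f₂ ≠ 0` —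
then at most 8 lines on `X` pass through `P`.  Lines are 2-dimensional subspaces of
`K⁴`. -/
theorem at_most_8_lines_through_double_point
    (K : Type*) [Field K] [IsAlgClosed K]
    (F : MvPolynomial (Fin 4) K) (hirr : Irreducible F) (hhom : F.IsHomogeneous 4)
    (v : Fin 4 → K) (hv : v ≠ 0) (hvX : eval v F = 0)
    (hdouble : ∃ A : Matrix (Fin 4) (Fin 4) K, IsUnit A.det ∧
      A.mulVec (Pi.single 3 1) = v ∧
      ∃ f₂ f₃ f₄ : MvPolynomial (Fin 4) K,
        f₂.IsHomogeneous 2 ∧ f₃.IsHomogeneous 3 ∧ f₄.IsHomogeneous 4 ∧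
        (∀ m ∈ f₂.support, m 3 = 0) ∧ (∀ m ∈ f₃.support, m 3 = 0) ∧
        (∀ m ∈ f₄.support, m 3 = 0) ∧
        bind₁ (fun i => ∑ j : Fin 4, C (A i j) * X j) F
          = X 3 ^ 2 * f₂ + X 3 * f₃ + f₄ ∧
        f₂ ≠ 0) :
    {W : Submodule K (Fin 4 → K) |
        Module.finrank K W = 2 ∧ (∀ w ∈ W, eval w F = 0) ∧ v ∈ W}.Finite ∧
    {W : Submodule K (Fin 4 → K) |
        Module.finrank K W = 2 ∧ (∀ w ∈ W, eval w F = 0) ∧ v ∈ W}.ncard ≤ 8 := by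
  have hinf : Infinite K := IsAlgClosed.instInfinite
  obtain ⟨A, hA, rfl, f₂, f₃, f₄, h₂, h₃, h₄, hs₂, hs₃, hs₄, hF, hf₂⟩ := hdouble
  obtain ⟨q, hq, rfl⟩ := exists_rename_castSucc h₂ hs₂
  obtain ⟨f, hf, rfl⟩ := exists_rename_castSucc h₃ hs₃
  obtain ⟨g, hg, rfl⟩ := exists_rename_castSucc h₄ hs₄
  have hq0 : q ≠ 0 := by
    rintro rfl
    exact hf₂ (map_zero _)
  have hF' : linSubst A F = _ := hF
  have hG := hhom.linSubst A
  have hGirr : Irreducible (linSubst A F) :=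
    (MulEquiv.irreducible_iff (linSubstEquiv A hA)).mpr hirr
  rw [hF'] at hG hGirr
  set S := {W : Submodule K (Fin 4 → K) | Module.finrank K W = 2 ∧ (∀ w ∈ W, eval w F = 0) ∧
    A.mulVec (Pi.single 3 1) ∈ W}
  have hpt : ∀ W ∈ S, ∃ x : Fin 3 → K, x ≠ 0 ∧
      W = Submodule.span K {A.mulVec (Pi.single 3 1), A.mulVec ![x 0, x 1, x 2, 0]} :=
    fun W hW => exists_span_pair_eq hA hW.1 hW.2.2
  choose! p hp0 hpW using hpt
  have hpmem : ∀ W ∈ S, A.mulVec ![p W 0, p W 1, p W 2, 0] ∈ W := fun W hW =>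
    (hpW W hW).ge (Submodule.subset_span (Set.mem_insert_of_mem _ rfl))
  have hzero : ∀ W ∈ S, eval (p W) q = 0 ∧ eval (p W) f = 0 ∧ eval (p W) g = 0 := by
    intro W hW
    have hpoly : Polynomial.C (eval (p W) q) * Polynomial.X ^ 2 +
        Polynomial.C (eval (p W) f) * Polynomial.X + Polynomial.C (eval (p W) g) = 0 := by
      apply Polynomial.funext
      intro t
      have hmem : A.mulVec ![p W 0, p W 1, p W 2, t] ∈ W := by
        have : ![p W 0, p W 1, p W 2, t] =
            t • Pi.single 3 1 + ![p W 0, p W 1, p W 2, 0] := by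
          ext k
          fin_cases k <;> simp
        rw [this, Matrix.mulVec_add, Matrix.mulVec_smul]
        exact add_mem (W.smul_mem _ hW.2.2) (hpmem W hW)
      have hev := hW.2.1 _ hmem
      have hcomp : ![p W 0, p W 1, p W 2, t] ∘ Fin.castSucc = p W := by
        ext k
        fin_cases k <;> rfl
      rw [← eval_linSubst, hF'] at hev
      simp only [map_add, map_mul, map_pow, eval_X, eval_rename, hcomp] at hev
      simp at hev ⊢
      linear_combination hev
    refine ⟨?_, ?_, ?_⟩
    · simpa using congrArg (Polynomial.coeff · 2) hpoly
    · simpa using congrArg (Polynomial.coeff · 1) hpoly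
    · simpa using congrArg (Polynomial.coeff · 0) hpoly
  have hpair : ∀ W ∈ S, ∀ W' ∈ S, W ≠ W' → LinearIndependent K ![p W, p W'] := by
    intro W hW W' hW' hne
    rw [LinearIndependent.pair_iff' (hp0 W hW)]
    intro c hc
    apply hne
    symm
    apply Submodule.eq_of_le_of_finrank_eq _ (hW'.1.trans hW.1.symm)
    have hsmul : ![p W' 0, p W' 1, p W' 2, 0] = c • ![p W 0, p W 1, p W 2, 0] := by
      rw [← hc]
      ext k
      fin_cases k <;> simp
    rw [hpW W' hW', Submodule.span_le]
    rintro z (rfl | rfl)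
    · exact hW.2.2
    · rw [hsmul, Matrix.mulVec_smul]
      exact W.smul_mem _ (hpmem W hW)
  have hbound : ∀ t : Finset (Submodule K (Fin 4 → K)), ↑t ⊆ S → t.card ≤ 8 := fun t ht =>
    card_le_eight hq hq0 hf hg (isUnit_of_dvd_of_irreducible hq hq0 hG hGirr) t p
      (fun W hW W' hW' => hpair W (ht hW) W' (ht hW')) (fun W hW => (hzero W (ht hW)).1)
      (fun W hW => (hzero W (ht hW)).2.1) fun W hW => (hzero W (ht hW)).2.2
  have hfin : S.Finite := by
    by_contra h
    obtain ⟨t, ht, hcard⟩ := Set.Infinite.exists_subset_card_eq h 9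
    have := hbound t ht
    omega
  refine ⟨hfin, ?_⟩
  rw [Set.ncard_eq_toFinset_card S hfin]
  exact hbound _ (by simp)
end

section
/- Let K be an algebraically closed field of arbitrary characteristic and let F = Σ_{i₀+i₁+i₂+i₃=4} a_{i₀i₁i₂i₃} x₀^{i₀}x₁^{i₁}x₂^{i₂}x₃^{i₃} be a nonzero quartic form with a_{i₀i₁00} = 0 for all i₀,i₁, so the line ℓ : x₀ = x₁ = 0 lies on X = {F = 0}. Let P = [0:0:0:1]. Suppose that for every t ∈ K the residual cubic E_t in the plane x₀ = t·x₁ is singular at P, i.e., g_t(x₁,x₂,x₃) := F(t·x₁, x₁, x₂, x₃)/x₁ vanishes at (x₁,x₂,x₃) = (0,0,1) together with all three of its partial derivatives, and that the same holds for the residual cubic F(x₀,0,x₂,x₃)/x₀ in the plane x₁ = 0. Then P is a triple point of X; that is, writing F = x₃³·f₁ + x₃²·f₂ + x₃·f₃ + f₄ with fᵢ homogeneous of degree i in x₀,x₁,x₂, one has f₁ = 0 and f₂ = 0. -/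
open MvPolynomial

/-- The exponent vector `(a, b, c, d)` as a monomial index for `MvPolynomial (Fin 4)`. -/
noncomputable def expo (a b c d : ℕ) : Fin 4 →₀ ℕ := Finsupp.equivFunOnFinite.symm ![a, b, c, d]

open Finset in
/-- The coefficients of the restriction of `F` to the plane `x₀ = t·x₁`. -/
theorem coeff_bind₁_plane {K : Type*} [Field K] (t : K) (F : MvPolynomial (Fin 4) K)
    (n₁ n₂ n₃ : ℕ) :
    coeff (expo 0 n₁ n₂ n₃) (bind₁ (fun i : Fin 4 => if i = 0 then C t * X 1 else X i) F) =
      ∑ p ∈ antidiagonal n₁, coeff (expo p.1 p.2 n₂ n₃) F * t ^ p.1 := by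
  induction F using MvPolynomial.induction_on' with
  | add p q hp hq => simp only [map_add, coeff_add, hp, hq, add_mul, sum_add_distrib]
  | monomial m a =>
    have hm : bind₁ (fun i : Fin 4 => if i = 0 then C t * X 1 else X i) (monomial m a) =
        monomial (expo 0 (m 0 + m 1) (m 2) (m 3)) (a * t ^ m 0) := by
      rw [bind₁, aeval_monomial, Finsupp.prod_fintype _ _ (fun _ => pow_zero _),
        Fin.prod_univ_four, monomial_eq (s := expo _ _ _ _),
        Finsupp.prod_fintype _ _ (fun _ => pow_zero _), Fin.prod_univ_four]
      simp [expo, algebraMap_eq]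
      ring
    have hexpo (a b c d : ℕ) : m = expo a b c d ↔ m 0 = a ∧ m 1 = b ∧ m 2 = c ∧ m 3 = d := by
      simp [Finsupp.ext_iff, Fin.forall_fin_succ, expo]
    have hexpo' : expo 0 (m 0 + m 1) (m 2) (m 3) = expo 0 n₁ n₂ n₃ ↔
        m 0 + m 1 = n₁ ∧ m 2 = n₂ ∧ m 3 = n₃ := by
      simp [expo]
    simp only [hm, coeff_monomial, hexpo, hexpo']
    split_ifs with h
    · rw [sum_eq_single (m 0, m 1)]
      · simp [h]
      · rintro ⟨b, c⟩ - hne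
        rw [if_neg fun h' => hne (by simp [h'.1, h'.2.1]), zero_mul]
      · simp [h]
    · refine (sum_eq_zero fun p hp => ?_).symm
      rw [HasAntidiagonal.mem_antidiagonal] at hp
      rw [if_neg fun h' => h ⟨by omega, h'.2.2⟩, zero_mul]

/-- The value of a form of degree `d` at the last coordinate point. -/
theorem MvPolynomial.IsHomogeneous.eval_last_point {K : Type*} [Field K]
    {g : MvPolynomial (Fin 4) K} {d : ℕ} (hg : g.IsHomogeneous d) :
    eval (![0, 0, 0, 1] : Fin 4 → K) g = coeff (expo 0 0 0 d) g := by
  rw [eval_eq', Finset.sum_eq_single (expo 0 0 0 d)]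
  · simp [Fin.prod_univ_four, expo]
  · intro m hm hne
    have hdeg : m.degree = d := by
      by_contra h
      exact mem_support_iff.1 hm (hg.coeff_eq_zero h)
    rw [Finsupp.degree_eq_sum, Fin.sum_univ_four] at hdeg
    have : m 0 ≠ 0 ∨ m 1 ≠ 0 ∨ m 2 ≠ 0 := by
      by_contra! h
      apply hne
      simp [Finsupp.ext_iff, Fin.forall_fin_succ, expo]
      omega
    rw [Fin.prod_univ_four]
    rcases this with h | h | h <;> simp [h]
  · intro h
    rw [notMem_support_iff.1 h, zero_mul]

/-- Let `F` be a nonzero quartic form, vanishing on the line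
`ℓ : x₀ = x₁ = 0` (i.e. all coefficients `a₀₀ᵢ₂ᵢ₃` vanish), over an algebraically
closed field.  Suppose that for every `t ∈ K` the residual cubic
`g_t = F(t·x₁, x₁, x₂, x₃)/x₁` is singular at the point `P = [0:0:0:1]` (it vanishes
at `(x₁,x₂,x₃) = (0,0,1)` together with all its partial derivatives), and likewise
for the residual cubic `F(x₀, 0, x₂, x₃)/x₀` of the plane `x₁ = 0`.  Then `P` is a
triple point of `X = {F = 0}`: writing `F = x₃³f₁ + x₃²f₂ + x₃f₃ + f₄`, one has
`f₁ = 0` and `f₂ = 0`, i.e. every monomial of `F` has `x₃`-exponent at most 1 except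
possibly the (absent) pure powers. -/
theorem residual_cubics_singular_gives_triple_point
    (K : Type*) [Field K] [IsAlgClosed K]
    (F : MvPolynomial (Fin 4) K) (hF0 : F ≠ 0) (hhom : F.IsHomogeneous 4)
    (hline : ∀ i₂ i₃ : ℕ, coeff (expo 0 0 i₂ i₃) F = 0)
    (hsing : ∀ t : K, ∃ g : MvPolynomial (Fin 4) K,
      bind₁ (fun i : Fin 4 => if i = 0 then C t * X 1 else X i) F = X 1 * g ∧
      eval (![0, 0, 0, 1] : Fin 4 → K) g = 0 ∧
      ∀ i : Fin 4, i ≠ 0 → eval (![0, 0, 0, 1] : Fin 4 → K) (pderiv i g) = 0)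
    (hsinginfty : ∃ g : MvPolynomial (Fin 4) K,
      bind₁ (fun i : Fin 4 => if i = 1 then 0 else X i) F = X 0 * g ∧
      eval (![0, 0, 0, 1] : Fin 4 → K) g = 0 ∧
      ∀ i : Fin 4, i ≠ 1 → eval (![0, 0, 0, 1] : Fin 4 → K) (pderiv i g) = 0) :
    ∀ m : Fin 4 →₀ ℕ, (m 3 = 2 ∨ m 3 = 3) → coeff m F = 0 := by
  have hexpo_add (a b c d a' b' c' d' : ℕ) :
      expo a b c d + expo a' b' c' d' = expo (a + a') (b + b') (c + c') (d + d') := by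
    simp [Finsupp.ext_iff, Fin.forall_fin_succ, expo]
  have hX1 : Finsupp.single (1 : Fin 4) 1 = expo 0 1 0 0 := by
    simp [Finsupp.ext_iff, Fin.forall_fin_succ, expo]
  have hX2 : Finsupp.single (2 : Fin 4) 1 = expo 0 0 1 0 := by
    simp [Finsupp.ext_iff, Fin.forall_fin_succ, expo]
  have key (t : K) :
      coeff (expo 0 1 0 3) F + coeff (expo 1 0 0 3) F * t = 0 ∧
      coeff (expo 0 2 0 2) F + coeff (expo 1 1 0 2) F * t + coeff (expo 2 0 0 2) F * t ^ 2 = 0 ∧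
      coeff (expo 0 1 1 2) F + coeff (expo 1 0 1 2) F * t = 0 := by
    obtain ⟨g, hFg, hg, hdg⟩ := hsing t
    have hcoeff (n₁ n₂ n₃ : ℕ) : coeff (expo 0 n₁ n₂ n₃) g =
        ∑ p ∈ Finset.HasAntidiagonal.antidiagonal (n₁ + 1), coeff (expo p.1 p.2 n₂ n₃) F * t ^ p.1 := by
      rw [← coeff_bind₁_plane, hFg, ← coeff_X_mul _ (1 : Fin 4), hX1, hexpo_add]
      simp only [zero_add, add_comm 1]
    have hres : (bind₁ (fun i : Fin 4 => if i = 0 then C t * X 1 else X i) F).IsHomogeneous 4 := by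
      change IsHomogeneous _ (1 * 4)
      refine hhom.aeval _ fun i => ?_
      split_ifs
      · exact isHomogeneous_C_mul_X t 1
      · exact isHomogeneous_X K i
    have hghom : g.IsHomogeneous 3 := by
      intro m hm
      rw [← coeff_X_mul _ (1 : Fin 4), ← hFg] at hm
      have := hres hm
      simp only [map_add, Finsupp.weight_single, Pi.one_apply, smul_eq_mul] at this
      omega
    rw [hghom.eval_last_point, hcoeff] at hg
    have h1 := hdg 1 (by decide)
    have h2 := hdg 2 (by decide)
    rw [hghom.pderiv.eval_last_point, coeff_pderiv] at h1 h2
    rw [hX1, hexpo_add, hcoeff] at h1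
    rw [hX2, hexpo_add, hcoeff] at h2
    simp [Finset.Nat.antidiagonal_succ, expo] at hg h1 h2
    refine ⟨?_, ?_, ?_⟩ <;> simp only [expo]
    · linear_combination hg
    · linear_combination h1
    · linear_combination h2
  classical
  obtain ⟨s, hs⟩ := Infinite.exists_notMem_finset ({0, 1} : Finset K)
  simp only [Finset.mem_insert, Finset.mem_singleton, not_or] at hs
  obtain ⟨a0, b0, c0⟩ := key 0
  obtain ⟨a1, b1, c1⟩ := key 1
  obtain ⟨-, bs, -⟩ := key s
  simp only [mul_zero, add_zero, ne_eq, OfNat.ofNat_ne_zero, not_false_eq_true, zero_pow] at a0 b0 c0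
  simp only [a0, b0, c0, mul_one, zero_add, one_pow] at a1 b1 c1 bs
  have h2002 : coeff (expo 2 0 0 2) F = 0 := by
    refine (mul_eq_zero.1 ?_).resolve_right (mul_ne_zero hs.1 (sub_ne_zero.2 hs.2))
    linear_combination bs - s * b1
  have h1102 : coeff (expo 1 1 0 2) F = 0 := by simpa [h2002] using b1
  intro m hm
  by_cases hdeg : m.degree = 4
  · have hm' : m = expo (m 0) (m 1) (m 2) (m 3) := by
      simp [Finsupp.ext_iff, Fin.forall_fin_succ, expo]
    rw [Finsupp.degree_eq_sum, Fin.sum_univ_four] at hdeg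
    rw [hm']
    generalize m 0 = a, m 1 = b, m 2 = c, m 3 = d at hm hdeg
    have ha : a ≤ 2 := by omega
    have hb : b ≤ 2 := by omega
    rcases hm with rfl | rfl <;> interval_cases a <;> interval_cases b <;>
      first
      | omega
      | simp only [hline]
      | (obtain rfl : c = 0 := by omega
         simp only [a0, a1, b0, h1102, h2002])
      | (obtain rfl : c = 1 := by omega
         simp only [c0, c1])
  · exact hhom.coeff_eq_zero hdeg
end

section
/- Let K be an algebraically closed field of characteristic 2, and let F = Σ a_{i₀i₁i₂i₃} x₀^{i₀}x₁^{i₁}x₂^{i₂}x₃^{i₃} be a quartic form with a_{i₀i₁00} = 0 for all i₀,i₁, normalized so that a_{1003} = a_{0103} = a_{0112} = a_{1030} = 0, a_{0130} = a_{1012} = 1, and a_{1021} = a_{0121} = 0 (so the line ℓ : x₀ = x₁ = 0 on X = {F = 0} is inseparable of degree 2). For s ∈ K, the point P_s := [0:0:s:1] is a singular point of the residual cubic E_{s²} in the plane x₀ = s²·x₁ — i.e., g_{s²}(x₁,x₂,x₃) := F(s²x₁, x₁, x₂, x₃)/x₁ and all three of its partial derivatives vanish at (x₁,x₂,x₃)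 = (0,s,1) — if and only if φ(s) = 0, where φ(s) := a_{2020}s⁶ + a_{2011}s⁵ + a_{1120}s⁴ + a_{2002}s⁴ + a_{1111}s³ + a_{0220}s² + a_{1102}s² + a_{0211}s + a_{0202}. -/
open MvPolynomial

/-- A quartic form in four variables is the sum of its monomials, indexed by the exponents of the
first three variables. -/
theorem isHomogeneous_four_eq_sum {R : Type*} [CommSemiring R] {F : MvPolynomial (Fin 4) R}
    (hF : F.IsHomogeneous 4) :
    F = ∑ a ∈ Finset.range 5, ∑ b ∈ Finset.range (5 - a), ∑ c ∈ Finset.range (5 - a - b),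
      C (coeff (expo a b c (4 - a - b - c)) F) *
        (X 0 ^ a * X 1 ^ b * X 2 ^ c * X 3 ^ (4 - a - b - c)) := by
  have hmon (a b c d : ℕ) (r : R) :
      C r * (X 0 ^ a * X 1 ^ b * X 2 ^ c * X 3 ^ d) = monomial (expo a b c d) r := by
    rw [monomial_eq, Finsupp.prod_fintype _ _ (fun _ => pow_zero _)]
    simp [expo, Fin.prod_univ_four]
  simp only [hmon, Finset.sum_sigma']
  conv_lhs => rw [F.as_sum]
  symm
  have hinj {a b c d a' b' c' d' : ℕ} (h : expo a b c d = expo a' b' c' d') :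
      a = a' ∧ b = b' ∧ c = c' ∧ d = d' := by
    have := Finsupp.equivFunOnFinite.symm.injective h
    simpa using this
  refine Finset.sum_bij_ne_zero (fun p _ _ => expo p.1 p.2.1 p.2.2 (4 - p.1 - p.2.1 - p.2.2))
    ?_ ?_ ?_ ?_
  · intro p _ hp
    rw [mem_support_iff]
    intro h
    simp [h] at hp
  · rintro ⟨a, b, c⟩ _ _ ⟨a', b', c'⟩ _ _ h
    obtain ⟨rfl, rfl, rfl, -⟩ := hinj h
    rfl
  · intro d hd hd'
    have hdeg : d 0 + d 1 + d 2 + d 3 = 4 := by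
      have := hF (mem_support_iff.mp hd)
      rw [Finsupp.weight_apply, Finsupp.sum_fintype _ _ (by simp)] at this
      simpa [Fin.sum_univ_four] using this
    have hexpo : expo (d 0) (d 1) (d 2) (4 - d 0 - d 1 - d 2) = d := by
      ext i
      fin_cases i <;> simp [expo]
      omega
    refine ⟨⟨d 0, d 1, d 2⟩, ?_, ?_, hexpo⟩
    · simp only [Finset.mem_sigma, Finset.mem_range]
      omega
    · simpa only [hexpo] using hd'
  · intros
    rfl

/-- For a quartic form `F` in characteristic 2, containing the line
`ℓ : x₀ = x₁ = 0` and normalized so that `a₁₀₀₃ = a₀₁₀₃ = a₀₁₁₂ = a₁₀₃₀ = 0`,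
`a₀₁₃₀ = a₁₀₁₂ = 1`, `a₁₀₂₁ = a₀₁₂₁ = 0` (so `ℓ` is inseparable of degree 2), the
residual cubic `g_{s²} = F(s²x₁, x₁, x₂, x₃)/x₁` is singular at `P_s = [0:0:s:1]` if
and only if `φ(s) = 0`, where
`φ(s) = a₂₀₂₀s⁶ + a₂₀₁₁s⁵ + a₁₁₂₀s⁴ + a₂₀₀₂s⁴ + a₁₁₁₁s³ + a₀₂₂₀s² + a₁₁₀₂s² + a₀₂₁₁s + a₀₂₀₂`. -/
theorem residual_cubic_singular_iff_phi_vanishes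
    (K : Type*) [Field K] [IsAlgClosed K] [CharP K 2]
    (F : MvPolynomial (Fin 4) K) (hF0 : F ≠ 0) (hhom : F.IsHomogeneous 4)
    (hline : ∀ i₂ i₃ : ℕ, coeff (expo 0 0 i₂ i₃) F = 0)
    (h1 : coeff (expo 1 0 0 3) F = 0) (h2 : coeff (expo 0 1 0 3) F = 0)
    (h3 : coeff (expo 0 1 1 2) F = 0) (h4 : coeff (expo 1 0 3 0) F = 0)
    (h5 : coeff (expo 0 1 3 0) F = 1) (h6 : coeff (expo 1 0 1 2) F = 1)
    (h7 : coeff (expo 1 0 2 1) F = 0) (h8 : coeff (expo 0 1 2 1) F = 0) :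
    ∀ s : K,
      (∃ g : MvPolynomial (Fin 4) K,
        bind₁ (fun i : Fin 4 => if i = 0 then C (s ^ 2) * X 1 else X i) F = X 1 * g ∧
        eval (![0, 0, s, 1] : Fin 4 → K) g = 0 ∧
        ∀ i : Fin 4, i ≠ 0 → eval (![0, 0, s, 1] : Fin 4 → K) (pderiv i g) = 0)
      ↔
      coeff (expo 2 0 2 0) F * s ^ 6 + coeff (expo 2 0 1 1) F * s ^ 5
        + coeff (expo 1 1 2 0) F * s ^ 4 + coeff (expo 2 0 0 2) F * s ^ 4
        + coeff (expo 1 1 1 1) F * s ^ 3 + coeff (expo 0 2 2 0) F * s ^ 2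
        + coeff (expo 1 1 0 2) F * s ^ 2 + coeff (expo 0 2 1 1) F * s
        + coeff (expo 0 2 0 2) F = 0 := by
  intro s
  obtain ⟨R, hfactor⟩ : ∃ R, bind₁ (fun i : Fin 4 => if i = 0 then C (s ^ 2) * X 1 else X i) F =
      X 1 * (C (s ^ 2) * X 2 * X 3 ^ 2 + X 2 ^ 3 +
        X 1 * (C (coeff (expo 2 0 0 2) F) * C (s ^ 2) ^ 2 * X 3 ^ 2 +
          C (coeff (expo 2 0 1 1) F) * C (s ^ 2) ^ 2 * X 2 * X 3 +
          C (coeff (expo 2 0 2 0) F) * C (s ^ 2) ^ 2 * X 2 ^ 2 +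
          C (coeff (expo 1 1 0 2) F) * C (s ^ 2) * X 3 ^ 2 +
          C (coeff (expo 1 1 1 1) F) * C (s ^ 2) * X 2 * X 3 +
          C (coeff (expo 1 1 2 0) F) * C (s ^ 2) * X 2 ^ 2 +
          C (coeff (expo 0 2 0 2) F) * X 3 ^ 2 +
          C (coeff (expo 0 2 1 1) F) * X 2 * X 3 +
          C (coeff (expo 0 2 2 0) F) * X 2 ^ 2) +
        X 1 ^ 2 * R) := by
    refine ⟨C (coeff (expo 3 0 0 1) F) * C (s ^ 2) ^ 3 * X 3 +
      C (coeff (expo 3 0 1 0) F) * C (s ^ 2) ^ 3 * X 2 +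
      C (coeff (expo 2 1 0 1) F) * C (s ^ 2) ^ 2 * X 3 +
      C (coeff (expo 2 1 1 0) F) * C (s ^ 2) ^ 2 * X 2 +
      C (coeff (expo 1 2 0 1) F) * C (s ^ 2) * X 3 +
      C (coeff (expo 1 2 1 0) F) * C (s ^ 2) * X 2 +
      C (coeff (expo 0 3 0 1) F) * X 3 +
      C (coeff (expo 0 3 1 0) F) * X 2 +
      C (coeff (expo 4 0 0 0) F) * C (s ^ 2) ^ 4 * X 1 +
      C (coeff (expo 3 1 0 0) F) * C (s ^ 2) ^ 3 * X 1 +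
      C (coeff (expo 2 2 0 0) F) * C (s ^ 2) ^ 2 * X 1 +
      C (coeff (expo 1 3 0 0) F) * C (s ^ 2) * X 1 +
      C (coeff (expo 0 4 0 0) F) * X 1, ?_⟩
    conv_lhs => rw [isHomogeneous_four_eq_sum hhom]
    simp [Finset.sum_range_succ, hline, h1, h2, h3, h4, h5, h6, h7, h8]
    ring
  have h_two : (2 : K) = 0 := CharTwo.two_eq_zero
  rw [hfactor]
  constructor
  · rintro ⟨g, hg, -, hderiv⟩
    obtain rfl := mul_left_cancel₀ (X_ne_zero 1) hg
    have := hderiv 1 (by decide)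
    simp [pderiv_X] at this
    linear_combination this
  · intro hφ
    refine ⟨_, rfl, ?_, ?_⟩
    · simp
      linear_combination s ^ 3 * h_two
    · intro i hi
      fin_cases i
      · exact absurd rfl hi
      · simp [pderiv_X]
        linear_combination hφ
      · simp [pderiv_X]
        linear_combination 2 * s ^ 2 * h_two
      · simp [pderiv_X]
        exact Or.inr h_two
end

section
/- Let K be an algebraically closed field of characteristic 2, and let F = Σ a_{i₀i₁i₂i₃} x₀^{i₀}x₁^{i₁}x₂^{i₂}x₃^{i₃} be a quartic form with a_{i₀i₁00} = 0 for all i₀,i₁, normalized so that a_{1003} = a_{0103} = a_{0112} = a_{1030} = 0, a_{0130} = a_{1012} = 1, and a_{1021} = a_{0121} = 0 (so the line ℓ : x₀ = x₁ = 0 on X = {F = 0} is inseparable of degree 2). If the polynomial φ(s) := a_{2020}s⁶ + a_{2011}s⁵ + a_{1120}s⁴ + a_{2002}s⁴ + a_{1111}s³ + a_{0220}s² + a_{1102}s² + a_{0211}s + a_{0202} is not identically zero, then at most 12 lines lying on X and distinct from ℓ meet ℓ at points that are smooth points of X. Consequently, an inseparable line whose valency exceeds 12 satisfies φ ≡ 0,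 i.e., every residual cubic E_{s²} is singular at its residual intersection point P_s = [0:0:s:1] with ℓ (the line ℓ is cuspidal). -/
open MvPolynomial

/-- The line `ℓ : x₀ = x₁ = 0`. -/
noncomputable def ell (K : Type*) [Field K] : Submodule K (Fin 4 → K) :=
  Submodule.span K {![0, 0, 1, 0], ![0, 0, 0, 1]}

/-- The polynomial `φ` attached to an inseparable line of degree 2. -/
noncomputable def phiPoly (K : Type*) [Field K] (F : MvPolynomial (Fin 4) K) : Polynomial K :=
  Polynomial.C (coeff (expo 2 0 2 0) F) * Polynomial.X ^ 6
    + Polynomial.C (coeff (expo 2 0 1 1) F) * Polynomial.X ^ 5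
    + Polynomial.C (coeff (expo 1 1 2 0) F) * Polynomial.X ^ 4
    + Polynomial.C (coeff (expo 2 0 0 2) F) * Polynomial.X ^ 4
    + Polynomial.C (coeff (expo 1 1 1 1) F) * Polynomial.X ^ 3
    + Polynomial.C (coeff (expo 0 2 2 0) F) * Polynomial.X ^ 2
    + Polynomial.C (coeff (expo 1 1 0 2) F) * Polynomial.X ^ 2
    + Polynomial.C (coeff (expo 0 2 1 1) F) * Polynomial.X
    + Polynomial.C (coeff (expo 0 2 0 2) F)

theorem monomial_expo {K : Type*} [Field K] (a b c d : ℕ) (r : K) :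
    monomial (expo a b c d) r = C r * X 0 ^ a * X 1 ^ b * X 2 ^ c * X 3 ^ d := by
  rw [monomial_eq, Finsupp.prod_fintype _ _ (by simp), Fin.prod_univ_four]
  simp [expo, mul_assoc]

theorem expo_apply_self (m : Fin 4 →₀ ℕ) : expo (m 0) (m 1) (m 2) (m 3) = m := by
  ext i
  fin_cases i <;> simp [expo]

/-- A quartic form is the sum of its terms, indexed by the first three exponents. -/
theorem eq_sum_monomial_expo {K : Type*} [Field K] {F : MvPolynomial (Fin 4) K}
    (hhom : F.IsHomogeneous 4) :
    F = ∑ a ∈ Finset.range 5, ∑ b ∈ Finset.range (5 - a), ∑ c ∈ Finset.range (5 - a - b),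
      monomial (expo a b c (4 - a - b - c)) (coeff (expo a b c (4 - a - b - c)) F) := by
  ext m
  simp only [coeff_sum, coeff_monomial]
  have hexpo : ∀ {a b c d : ℕ}, expo a b c d = m → a = m 0 ∧ b = m 1 ∧ c = m 2 ∧ d = m 3 := by
    rintro a b c d rfl
    simp [expo]
  by_cases hm : m.degree = 4
  · have hsum : m 0 + m 1 + m 2 + m 3 = 4 := by
      rwa [Finsupp.degree_eq_sum, Fin.sum_univ_four] at hm
    have hd : 4 - m 0 - m 1 - m 2 = m 3 := by omega
    rw [Finset.sum_eq_single (m 0), Finset.sum_eq_single (m 1), Finset.sum_eq_single (m 2), hd,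
      expo_apply_self, if_pos rfl]
    · exact fun c _ hc => if_neg fun h => hc (hexpo h).2.2.1
    · exact fun h => absurd (Finset.mem_range.2 (by omega)) h
    · exact fun b _ hb => Finset.sum_eq_zero fun c _ => if_neg fun h => hb (hexpo h).2.1
    · exact fun h => absurd (Finset.mem_range.2 (by omega)) h
    · exact fun a _ ha => Finset.sum_eq_zero fun b _ => Finset.sum_eq_zero fun c _ =>
        if_neg fun h => ha (hexpo h).1
    · exact fun h => absurd (Finset.mem_range.2 (by omega)) h
  · rw [hhom.coeff_eq_zero hm]
    refine (Finset.sum_eq_zero fun a ha => Finset.sum_eq_zero fun b hb =>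
      Finset.sum_eq_zero fun c hc => if_neg fun h => hm ?_).symm
    simp only [Finset.mem_range] at ha hb hc
    obtain ⟨h0, h1, h2, h3⟩ := hexpo h
    rw [Finsupp.degree_eq_sum, Fin.sum_univ_four]
    omega

/-- The normal form of a quartic containing `ℓ` as an inseparable line of degree 2. -/
theorem eq_normalForm {K : Type*} [Field K] {F : MvPolynomial (Fin 4) K}
    (hhom : F.IsHomogeneous 4)
    (hline : ∀ i₂ i₃ : ℕ, coeff (expo 0 0 i₂ i₃) F = 0)
    (h1 : coeff (expo 1 0 0 3) F = 0) (h2 : coeff (expo 0 1 0 3) F = 0)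
    (h3 : coeff (expo 0 1 1 2) F = 0) (h4 : coeff (expo 1 0 3 0) F = 0)
    (h5 : coeff (expo 0 1 3 0) F = 1) (h6 : coeff (expo 1 0 1 2) F = 1)
    (h7 : coeff (expo 1 0 2 1) F = 0) (h8 : coeff (expo 0 1 2 1) F = 0) :
    F = X 0 * X 2 * X 3 ^ 2 + X 1 * X 2 ^ 3
      + (C (coeff (expo 2 0 2 0) F) * X 0 ^ 2 + C (coeff (expo 1 1 2 0) F) * X 0 * X 1
        + C (coeff (expo 0 2 2 0) F) * X 1 ^ 2) * X 2 ^ 2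
      + (C (coeff (expo 2 0 1 1) F) * X 0 ^ 2 + C (coeff (expo 1 1 1 1) F) * X 0 * X 1
        + C (coeff (expo 0 2 1 1) F) * X 1 ^ 2) * X 2 * X 3
      + (C (coeff (expo 2 0 0 2) F) * X 0 ^ 2 + C (coeff (expo 1 1 0 2) F) * X 0 * X 1
        + C (coeff (expo 0 2 0 2) F) * X 1 ^ 2) * X 3 ^ 2
      + (C (coeff (expo 3 0 1 0) F) * X 0 ^ 3 + C (coeff (expo 2 1 1 0) F) * X 0 ^ 2 * X 1
        + C (coeff (expo 1 2 1 0) F) * X 0 * X 1 ^ 2 + C (coeff (expo 0 3 1 0) F) * X 1 ^ 3) * X 2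
      + (C (coeff (expo 3 0 0 1) F) * X 0 ^ 3 + C (coeff (expo 2 1 0 1) F) * X 0 ^ 2 * X 1
        + C (coeff (expo 1 2 0 1) F) * X 0 * X 1 ^ 2 + C (coeff (expo 0 3 0 1) F) * X 1 ^ 3) * X 3
      + (C (coeff (expo 4 0 0 0) F) * X 0 ^ 4 + C (coeff (expo 3 1 0 0) F) * X 0 ^ 3 * X 1
        + C (coeff (expo 2 2 0 0) F) * X 0 ^ 2 * X 1 ^ 2
        + C (coeff (expo 1 3 0 0) F) * X 0 * X 1 ^ 3 + C (coeff (expo 0 4 0 0) F) * X 1 ^ 4) := by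
  conv_lhs => rw [eq_sum_monomial_expo hhom]
  simp only [Finset.sum_range_succ, Finset.sum_range_zero, Nat.reduceSub, monomial_expo, hline,
    h1, h2, h3, h4, h5, h6, h7, h8, map_zero, map_one]
  ring

theorem eq_zero_of_forall_quartic_eq_zero {K : Type*} [Field K] [Infinite K] {a b c d : K}
    (h : ∀ x : K, a * x + b * x ^ 2 + c * x ^ 3 + d * x ^ 4 = 0) :
    a = 0 ∧ b = 0 ∧ c = 0 ∧ d = 0 := by
  have hp : Polynomial.C a * Polynomial.X + Polynomial.C b * Polynomial.X ^ 2
      + Polynomial.C c * Polynomial.X ^ 3 + Polynomial.C d * Polynomial.X ^ 4 = 0 :=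
    Polynomial.funext fun x => by simpa using h x
  have hc := fun n => congrArg (fun p : Polynomial K => p.coeff n) hp
  refine ⟨?_, ?_, ?_, ?_⟩
  · simpa [Polynomial.coeff_X, Polynomial.coeff_X_pow] using hc 1
  · simpa [Polynomial.coeff_X, Polynomial.coeff_X_pow] using hc 2
  · simpa [Polynomial.coeff_X, Polynomial.coeff_X_pow] using hc 3
  · simpa [Polynomial.coeff_X, Polynomial.coeff_X_pow] using hc 4

theorem mem_ell_iff {K : Type*} [Field K] {v : Fin 4 → K} : v ∈ ell K ↔ v 0 = 0 ∧ v 1 = 0 := by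
  rw [ell, Submodule.mem_span_pair]
  constructor
  · rintro ⟨a, b, rfl⟩
    simp
  · rintro ⟨h0, h1⟩
    refine ⟨v 2, v 3, ?_⟩
    ext i
    fin_cases i <;> simp [h0, h1]

theorem exists_mem_notMem_ell {K : Type*} [Field K] {W : Submodule K (Fin 4 → K)}
    (hW : Module.finrank K W = 2) (hne : W ≠ ell K) : ∃ w ∈ W, w ∉ ell K := by
  by_contra! h
  refine hne (Submodule.eq_of_le_of_finrank_le h ?_)
  rw [hW]
  classical
  have := finrank_span_finset_le_card (R := K)
    ({![0, 0, 1, 0], ![0, 0, 0, 1]} : Finset (Fin 4 → K))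
  simp only [Finset.coe_insert, Finset.coe_singleton] at this
  exact this.trans Finset.card_le_two

/-- The line joining `[0:0:1:q]` to `[1:q²:0:b]`. -/
noncomputable def tangentLine {K : Type*} [Field K] (q b : K) : Submodule K (Fin 4 → K) :=
  Submodule.span K {![0, 0, 1, q], ![1, q ^ 2, 0, b]}

theorem eq_tangentLine {K : Type*} [Field K] {W : Submodule K (Fin 4 → K)} {q b : K}
    (hW : Module.finrank K W = 2) (hv : ![0, 0, 1, q] ∈ W) (hw : ![1, q ^ 2, 0, b] ∈ W) :
    W = tangentLine q b := by
  symm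
  refine Submodule.eq_of_le_of_finrank_le ?_ ?_
  · rw [tangentLine, Submodule.span_le]
    rintro x (rfl | rfl)
    exacts [hv, hw]
  · have hli : LinearIndependent K ![![0, 0, 1, q], ![1, q ^ 2, 0, b]] := by
      rw [LinearIndependent.pair_iff]
      intro s t h
      have h0 := congrFun h 0
      have h2 := congrFun h 2
      simp at h0 h2
      exact ⟨h2, h0⟩
    have := finrank_span_eq_card hli
    rw [Matrix.range_cons, Matrix.range_cons, Matrix.range_empty, Set.union_empty] at this
    rw [hW, tangentLine]
    exact this.ge

/-- For a line through `[0:0:1:q]` lying on a quartic in normal form, the coefficients of the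
restriction of the quartic to the line vanish. -/
theorem restriction_coeffs_eq_zero {K : Type*} [Field K] [Infinite K] [CharP K 2]
    {F : MvPolynomial (Fin 4) K} {W : Submodule K (Fin 4 → K)}
    (hhom : F.IsHomogeneous 4)
    (hline : ∀ i₂ i₃ : ℕ, coeff (expo 0 0 i₂ i₃) F = 0)
    (h1 : coeff (expo 1 0 0 3) F = 0) (h2 : coeff (expo 0 1 0 3) F = 0)
    (h3 : coeff (expo 0 1 1 2) F = 0) (h4 : coeff (expo 1 0 3 0) F = 0)
    (h5 : coeff (expo 0 1 3 0) F = 1) (h6 : coeff (expo 1 0 1 2) F = 1)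
    (h7 : coeff (expo 1 0 2 1) F = 0) (h8 : coeff (expo 0 1 2 1) F = 0)
    (hF : ∀ v ∈ W, eval v F = 0) {q u₀ u₁ b : K}
    (hv : ![0, 0, 1, q] ∈ W) (hw : ![u₀, u₁, 0, b] ∈ W) :
    u₀ * q ^ 2 + u₁ = 0 ∧
    coeff (expo 2 0 2 0) F * u₀ ^ 2 + coeff (expo 1 1 2 0) F * u₀ * u₁
        + coeff (expo 0 2 2 0) F * u₁ ^ 2
      + (coeff (expo 2 0 1 1) F * u₀ ^ 2 + coeff (expo 1 1 1 1) F * u₀ * u₁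
        + coeff (expo 0 2 1 1) F * u₁ ^ 2) * q
      + (coeff (expo 2 0 0 2) F * u₀ ^ 2 + coeff (expo 1 1 0 2) F * u₀ * u₁
        + coeff (expo 0 2 0 2) F * u₁ ^ 2) * q ^ 2 = 0 ∧
    u₀ * b ^ 2 + (coeff (expo 2 0 1 1) F * u₀ ^ 2 + coeff (expo 1 1 1 1) F * u₀ * u₁
        + coeff (expo 0 2 1 1) F * u₁ ^ 2) * b
      + (coeff (expo 3 0 1 0) F * u₀ ^ 3 + coeff (expo 2 1 1 0) F * u₀ ^ 2 * u₁
        + coeff (expo 1 2 1 0) F * u₀ * u₁ ^ 2 + coeff (expo 0 3 1 0) F * u₁ ^ 3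
        + (coeff (expo 3 0 0 1) F * u₀ ^ 3 + coeff (expo 2 1 0 1) F * u₀ ^ 2 * u₁
        + coeff (expo 1 2 0 1) F * u₀ * u₁ ^ 2 + coeff (expo 0 3 0 1) F * u₁ ^ 3) * q) = 0 := by
  have hnf := eq_normalForm hhom hline h1 h2 h3 h4 h5 h6 h7 h8
  generalize coeff (expo 2 0 2 0) F = a2020, coeff (expo 1 1 2 0) F = a1120,
    coeff (expo 0 2 2 0) F = a0220, coeff (expo 2 0 1 1) F = a2011,
    coeff (expo 1 1 1 1) F = a1111, coeff (expo 0 2 1 1) F = a0211,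
    coeff (expo 2 0 0 2) F = a2002, coeff (expo 1 1 0 2) F = a1102,
    coeff (expo 0 2 0 2) F = a0202, coeff (expo 3 0 1 0) F = a3010,
    coeff (expo 2 1 1 0) F = a2110, coeff (expo 1 2 1 0) F = a1210,
    coeff (expo 0 3 1 0) F = a0310, coeff (expo 3 0 0 1) F = a3001,
    coeff (expo 2 1 0 1) F = a2101, coeff (expo 1 2 0 1) F = a1201,
    coeff (expo 0 3 0 1) F = a0301, coeff (expo 4 0 0 0) F = a4000,
    coeff (expo 3 1 0 0) F = a3100, coeff (expo 2 2 0 0) F = a2200,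
    coeff (expo 1 3 0 0) F = a1300, coeff (expo 0 4 0 0) F = a0400 at hnf ⊢
  have key := fun x : K => hF _ (W.add_mem hv (W.smul_mem x hw))
  simp only [hnf, map_add, map_mul, map_pow, eval_X, eval_C, Pi.add_apply, Pi.smul_apply,
    smul_eq_mul, Matrix.cons_val, zero_add, mul_zero, add_zero, one_pow, mul_one] at key
  have two : (2 : K) = 0 := CharTwo.two_eq_zero
  obtain ⟨c1, c2, c3, -⟩ := eq_zero_of_forall_quartic_eq_zero
    (a := u₀ * q ^ 2 + u₁)
    (b := a2020 * u₀ ^ 2 + a1120 * u₀ * u₁ + a0220 * u₁ ^ 2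
      + (a2011 * u₀ ^ 2 + a1111 * u₀ * u₁ + a0211 * u₁ ^ 2) * q
      + (a2002 * u₀ ^ 2 + a1102 * u₀ * u₁ + a0202 * u₁ ^ 2) * q ^ 2)
    (c := u₀ * b ^ 2 + (a2011 * u₀ ^ 2 + a1111 * u₀ * u₁ + a0211 * u₁ ^ 2) * b
      + (a3010 * u₀ ^ 3 + a2110 * u₀ ^ 2 * u₁ + a1210 * u₀ * u₁ ^ 2 + a0310 * u₁ ^ 3
        + (a3001 * u₀ ^ 3 + a2101 * u₀ ^ 2 * u₁ + a1201 * u₀ * u₁ ^ 2 + a0301 * u₁ ^ 3) * q))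
    (d := (a2002 * u₀ ^ 2 + a1102 * u₀ * u₁ + a0202 * u₁ ^ 2) * b ^ 2
      + (a3001 * u₀ ^ 3 + a2101 * u₀ ^ 2 * u₁ + a1201 * u₀ * u₁ ^ 2 + a0301 * u₁ ^ 3) * b
      + a4000 * u₀ ^ 4 + a3100 * u₀ ^ 3 * u₁ + a2200 * u₀ ^ 2 * u₁ ^ 2 + a1300 * u₀ * u₁ ^ 3
      + a0400 * u₁ ^ 4)
    (fun x => by
      linear_combination key x - (u₀ * q * b * x ^ 2
        + (a2002 * u₀ ^ 2 + a1102 * u₀ * u₁ + a0202 * u₁ ^ 2) * q * b * x ^ 3) * two)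
  exact ⟨c1, c2, c3⟩

/-- The monic quadratic whose roots `b` include all those for which `tangentLine q b` lies on the
quartic. -/
noncomputable def lineQuadratic {K : Type*} [Field K] (F : MvPolynomial (Fin 4) K) (q : K) :
    Polynomial K :=
  Polynomial.X ^ 2
    + Polynomial.C (coeff (expo 2 0 1 1) F + coeff (expo 1 1 1 1) F * q ^ 2
      + coeff (expo 0 2 1 1) F * (q ^ 2) ^ 2) * Polynomial.X
    + Polynomial.C (coeff (expo 3 0 1 0) F + coeff (expo 2 1 1 0) F * q ^ 2
      + coeff (expo 1 2 1 0) F * (q ^ 2) ^ 2 + coeff (expo 0 3 1 0) F * (q ^ 2) ^ 3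
      + (coeff (expo 3 0 0 1) F + coeff (expo 2 1 0 1) F * q ^ 2
      + coeff (expo 1 2 0 1) F * (q ^ 2) ^ 2 + coeff (expo 0 3 0 1) F * (q ^ 2) ^ 3) * q)

theorem lineQuadratic_natDegree {K : Type*} [Field K] (F : MvPolynomial (Fin 4) K) (q : K) :
    (lineQuadratic F q).natDegree = 2 := by
  unfold lineQuadratic
  compute_degree!

theorem reflect_phiPoly {K : Type*} [Field K] (F : MvPolynomial (Fin 4) K) :
    (phiPoly K F).reflect 6 = Polynomial.C (coeff (expo 2 0 2 0) F)
      + Polynomial.C (coeff (expo 2 0 1 1) F) * Polynomial.X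
      + Polynomial.C (coeff (expo 1 1 2 0) F) * Polynomial.X ^ 2
      + Polynomial.C (coeff (expo 2 0 0 2) F) * Polynomial.X ^ 2
      + Polynomial.C (coeff (expo 1 1 1 1) F) * Polynomial.X ^ 3
      + Polynomial.C (coeff (expo 0 2 2 0) F) * Polynomial.X ^ 4
      + Polynomial.C (coeff (expo 1 1 0 2) F) * Polynomial.X ^ 4
      + Polynomial.C (coeff (expo 0 2 1 1) F) * Polynomial.X ^ 5
      + Polynomial.C (coeff (expo 0 2 0 2) F) * Polynomial.X ^ 6 := by
  have h (n : ℕ) (hn : n ≤ 6) : Polynomial.revAt 6 n = 6 - n := Polynomial.revAt_le hn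
  rw [phiPoly, ← pow_one (Polynomial.C (coeff (expo 0 2 1 1) F) * Polynomial.X), mul_pow,
    pow_one]
  simp only [Polynomial.reflect_add, Polynomial.reflect_C_mul_X_pow, Polynomial.reflect_C]
  simp [h]

theorem reflect_phiPoly_natDegree_le {K : Type*} [Field K] (F : MvPolynomial (Fin 4) K) :
    ((phiPoly K F).reflect 6).natDegree ≤ 6 := by
  rw [reflect_phiPoly]
  compute_degree

/-- Every line on the quartic other than `ℓ` that meets `ℓ` at a smooth point is one of the lines
`tangentLine q b` with `q` a root of the reversed `φ`. -/
theorem exists_eq_tangentLine {K : Type*} [Field K] [Infinite K] [CharP K 2]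
    {F : MvPolynomial (Fin 4) K} {W : Submodule K (Fin 4 → K)}
    (hhom : F.IsHomogeneous 4)
    (hline : ∀ i₂ i₃ : ℕ, coeff (expo 0 0 i₂ i₃) F = 0)
    (h1 : coeff (expo 1 0 0 3) F = 0) (h2 : coeff (expo 0 1 0 3) F = 0)
    (h3 : coeff (expo 0 1 1 2) F = 0) (h4 : coeff (expo 1 0 3 0) F = 0)
    (h5 : coeff (expo 0 1 3 0) F = 1) (h6 : coeff (expo 1 0 1 2) F = 1)
    (h7 : coeff (expo 1 0 2 1) F = 0) (h8 : coeff (expo 0 1 2 1) F = 0)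
    (hW : Module.finrank K W = 2) (hF : ∀ v ∈ W, eval v F = 0) (hne : W ≠ ell K)
    {v : Fin 4 → K} (hvW : v ∈ W) (hvell : v ∈ ell K)
    {i : Fin 4} (hi : eval v (pderiv i F) ≠ 0) :
    ∃ q b : K, ((phiPoly K F).reflect 6).IsRoot q ∧ (lineQuadratic F q).IsRoot b ∧
      W = tangentLine q b := by
  rw [mem_ell_iff] at hvell
  obtain ⟨hv0, hv1⟩ := hvell
  have hv2 : v 2 ≠ 0 := by
    rintro hv2
    apply hi
    rw [eq_normalForm hhom hline h1 h2 h3 h4 h5 h6 h7 h8]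
    fin_cases i <;> simp [Derivation.leibniz_pow, pderiv_X, hv0, hv1, hv2]
  obtain ⟨w, hwW, hw⟩ := exists_mem_notMem_ell hW hne
  set q := (v 2)⁻¹ * v 3 with hq
  have hv' : ![0, 0, 1, q] ∈ W := by
    convert W.smul_mem (v 2)⁻¹ hvW using 1
    ext j
    fin_cases j <;> simp [hv0, hv1, hv2, hq]
  have hw' : ![w 0, w 1, 0, w 3 - w 2 * q] ∈ W := by
    convert W.sub_mem hwW (W.smul_mem (w 2) hv') using 1
    ext j
    fin_cases j <;> simp
  have hw1 : w 1 = w 0 * q ^ 2 := (CharTwo.add_eq_zero.1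
    (restriction_coeffs_eq_zero hhom hline h1 h2 h3 h4 h5 h6 h7 h8 hF hv' hw').1).symm
  have hw0 : w 0 ≠ 0 := fun h => hw (mem_ell_iff.2 ⟨h, by rw [hw1, h, zero_mul]⟩)
  set b := (w 0)⁻¹ * (w 3 - w 2 * q) with hb
  have hw'' : ![1, q ^ 2, 0, b] ∈ W := by
    convert W.smul_mem (w 0)⁻¹ hw' using 1
    ext j
    fin_cases j <;> simp [hw1, hw0, hb]
  obtain ⟨-, hc2, hc3⟩ :=
    restriction_coeffs_eq_zero hhom hline h1 h2 h3 h4 h5 h6 h7 h8 hF hv' hw''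
  refine ⟨q, b, ?_, ?_, eq_tangentLine hW hv' hw''⟩
  · rw [reflect_phiPoly, Polynomial.IsRoot]
    simp only [Polynomial.eval_add, Polynomial.eval_mul, Polynomial.eval_pow, Polynomial.eval_C,
      Polynomial.eval_X]
    linear_combination hc2
  · rw [lineQuadratic, Polynomial.IsRoot]
    simp only [Polynomial.eval_add, Polynomial.eval_mul, Polynomial.eval_pow, Polynomial.eval_C,
      Polynomial.eval_X]
    linear_combination hc3

/-- If `φ = 0`, each residual cubic is singular at its residual intersection point with `ℓ`. -/
theorem exists_residualCubic_singular {K : Type*} [Field K] [CharP K 2]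
    {F : MvPolynomial (Fin 4) K} (hhom : F.IsHomogeneous 4)
    (hline : ∀ i₂ i₃ : ℕ, coeff (expo 0 0 i₂ i₃) F = 0)
    (h1 : coeff (expo 1 0 0 3) F = 0) (h2 : coeff (expo 0 1 0 3) F = 0)
    (h3 : coeff (expo 0 1 1 2) F = 0) (h4 : coeff (expo 1 0 3 0) F = 0)
    (h5 : coeff (expo 0 1 3 0) F = 1) (h6 : coeff (expo 1 0 1 2) F = 1)
    (h7 : coeff (expo 1 0 2 1) F = 0) (h8 : coeff (expo 0 1 2 1) F = 0)
    (hphi : phiPoly K F = 0) (s : K) :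
    ∃ g : MvPolynomial (Fin 4) K,
      bind₁ (fun i : Fin 4 => if i = 0 then C (s ^ 2) * X 1 else X i) F = X 1 * g ∧
      eval (![0, 0, s, 1] : Fin 4 → K) g = 0 ∧
      ∀ i : Fin 4, i ≠ 0 → eval (![0, 0, s, 1] : Fin 4 → K) (pderiv i g) = 0 := by
  have hnf := eq_normalForm hhom hline h1 h2 h3 h4 h5 h6 h7 h8
  have hs := congrArg (Polynomial.eval s) hphi
  simp only [phiPoly, Polynomial.eval_add, Polynomial.eval_mul, Polynomial.eval_pow,
    Polynomial.eval_C, Polynomial.eval_X, Polynomial.eval_zero] at hs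
  generalize coeff (expo 2 0 2 0) F = a2020, coeff (expo 1 1 2 0) F = a1120,
    coeff (expo 0 2 2 0) F = a0220, coeff (expo 2 0 1 1) F = a2011,
    coeff (expo 1 1 1 1) F = a1111, coeff (expo 0 2 1 1) F = a0211,
    coeff (expo 2 0 0 2) F = a2002, coeff (expo 1 1 0 2) F = a1102,
    coeff (expo 0 2 0 2) F = a0202, coeff (expo 3 0 1 0) F = a3010,
    coeff (expo 2 1 1 0) F = a2110, coeff (expo 1 2 1 0) F = a1210,
    coeff (expo 0 3 1 0) F = a0310, coeff (expo 3 0 0 1) F = a3001,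
    coeff (expo 2 1 0 1) F = a2101, coeff (expo 1 2 0 1) F = a1201,
    coeff (expo 0 3 0 1) F = a0301, coeff (expo 4 0 0 0) F = a4000,
    coeff (expo 3 1 0 0) F = a3100, coeff (expo 2 2 0 0) F = a2200,
    coeff (expo 1 3 0 0) F = a1300, coeff (expo 0 4 0 0) F = a0400 at hnf hs
  have two : (2 : K) = 0 := CharTwo.two_eq_zero
  refine ⟨C (s ^ 2) * X 2 * X 3 ^ 2 + X 2 ^ 3
      + C (a2020 * s ^ 4 + a1120 * s ^ 2 + a0220) * X 1 * X 2 ^ 2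
      + C (a2011 * s ^ 4 + a1111 * s ^ 2 + a0211) * X 1 * X 2 * X 3
      + C (a2002 * s ^ 4 + a1102 * s ^ 2 + a0202) * X 1 * X 3 ^ 2
      + C (a3010 * s ^ 6 + a2110 * s ^ 4 + a1210 * s ^ 2 + a0310) * X 1 ^ 2 * X 2
      + C (a3001 * s ^ 6 + a2101 * s ^ 4 + a1201 * s ^ 2 + a0301) * X 1 ^ 2 * X 3
      + C (a4000 * s ^ 8 + a3100 * s ^ 6 + a2200 * s ^ 4 + a1300 * s ^ 2 + a0400) * X 1 ^ 3,
    ?_, ?_, ?_⟩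
  · rw [hnf]
    simp only [map_add, map_mul, map_pow, bind₁_X_right, if_true,
      Fin.reduceEq, if_false, algHom_C, algebraMap_eq]
    ring
  · simp only [map_add, map_mul, map_pow, eval_X, eval_C, Matrix.cons_val]
    linear_combination s ^ 3 * two
  · intro i hi
    fin_cases i
    · exact absurd rfl hi
    · simp [Derivation.leibniz_pow, pderiv_X]
      linear_combination hs
    · simp [Derivation.leibniz_pow, pderiv_X]
      linear_combination 2 * s ^ 2 * two
    · simp [Derivation.leibniz_pow, pderiv_X, two]

/-- For a quartic form `F` in characteristic 2 with an inseparable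
line `ℓ : x₀ = x₁ = 0` of degree 2 (normalized as indicated): if `φ` is not
identically zero, then at most 12 lines on `X = {F = 0}` distinct from `ℓ` meet `ℓ`
at smooth points of `X`.  Consequently, if more than 12 such lines exist (or
infinitely many), then `φ ≡ 0`, i.e. every residual cubic `g_{s²}` is singular at its
residual intersection point `P_s = [0:0:s:1]` with `ℓ` (the line `ℓ` is cuspidal). -/
theorem inseparable_line_valency_gt_12_is_cuspidal
    (K : Type*) [Field K] [IsAlgClosed K] [CharP K 2]
    (F : MvPolynomial (Fin 4) K) (hF0 : F ≠ 0) (hhom : F.IsHomogeneous 4)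
    (hline : ∀ i₂ i₃ : ℕ, coeff (expo 0 0 i₂ i₃) F = 0)
    (h1 : coeff (expo 1 0 0 3) F = 0) (h2 : coeff (expo 0 1 0 3) F = 0)
    (h3 : coeff (expo 0 1 1 2) F = 0) (h4 : coeff (expo 1 0 3 0) F = 0)
    (h5 : coeff (expo 0 1 3 0) F = 1) (h6 : coeff (expo 1 0 1 2) F = 1)
    (h7 : coeff (expo 1 0 2 1) F = 0) (h8 : coeff (expo 0 1 2 1) F = 0) :
    (phiPoly K F ≠ 0 →
      {W : Submodule K (Fin 4 → K) |
          Module.finrank K W = 2 ∧ (∀ v ∈ W, eval v F = 0) ∧ W ≠ ell K ∧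
          ∃ v : Fin 4 → K, v ≠ 0 ∧ v ∈ W ∧ v ∈ ell K ∧
            ∃ i : Fin 4, eval v (pderiv i F) ≠ 0}.Finite ∧
      {W : Submodule K (Fin 4 → K) |
          Module.finrank K W = 2 ∧ (∀ v ∈ W, eval v F = 0) ∧ W ≠ ell K ∧
          ∃ v : Fin 4 → K, v ≠ 0 ∧ v ∈ W ∧ v ∈ ell K ∧
            ∃ i : Fin 4, eval v (pderiv i F) ≠ 0}.ncard ≤ 12) ∧
    ((¬ {W : Submodule K (Fin 4 → K) |
          Module.finrank K W = 2 ∧ (∀ v ∈ W, eval v F = 0) ∧ W ≠ ell K ∧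
          ∃ v : Fin 4 → K, v ≠ 0 ∧ v ∈ W ∧ v ∈ ell K ∧
            ∃ i : Fin 4, eval v (pderiv i F) ≠ 0}.Finite ∨
      12 < {W : Submodule K (Fin 4 → K) |
          Module.finrank K W = 2 ∧ (∀ v ∈ W, eval v F = 0) ∧ W ≠ ell K ∧
          ∃ v : Fin 4 → K, v ≠ 0 ∧ v ∈ W ∧ v ∈ ell K ∧
            ∃ i : Fin 4, eval v (pderiv i F) ≠ 0}.ncard) →
      phiPoly K F = 0 ∧
      ∀ s : K, ∃ g : MvPolynomial (Fin 4) K,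
        bind₁ (fun i : Fin 4 => if i = 0 then C (s ^ 2) * X 1 else X i) F = X 1 * g ∧
        eval (![0, 0, s, 1] : Fin 4 → K) g = 0 ∧
        ∀ i : Fin 4, i ≠ 0 → eval (![0, 0, s, 1] : Fin 4 → K) (pderiv i g) = 0) := by
  set S := {W : Submodule K (Fin 4 → K) |
    Module.finrank K W = 2 ∧ (∀ v ∈ W, eval v F = 0) ∧ W ≠ ell K ∧
    ∃ v : Fin 4 → K, v ≠ 0 ∧ v ∈ W ∧ v ∈ ell K ∧
      ∃ i : Fin 4, eval v (pderiv i F) ≠ 0}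
  have hfin : phiPoly K F ≠ 0 → S.Finite ∧ S.ncard ≤ 12 := by
    intro hphi
    classical
    let T : Finset (Submodule K (Fin 4 → K)) :=
      ((phiPoly K F).reflect 6).roots.toFinset.biUnion fun q =>
        (lineQuadratic F q).roots.toFinset.image (tangentLine q)
    have hST : S ⊆ T := by
      rintro W ⟨hW, hF, hne, v, -, hvW, hvell, i, hi⟩
      obtain ⟨q, b, hq, hb, rfl⟩ :=
        exists_eq_tangentLine hhom hline h1 h2 h3 h4 h5 h6 h7 h8 hW hF hne hvW hvell hi
      have hquad : lineQuadratic F q ≠ 0 :=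
        Polynomial.ne_zero_of_natDegree_gt (n := 1) (by rw [lineQuadratic_natDegree]; norm_num)
      have hrefl : (phiPoly K F).reflect 6 ≠ 0 := by rwa [Ne, Polynomial.reflect_eq_zero_iff]
      simp only [T, Finset.mem_coe, Finset.mem_biUnion, Finset.mem_image, Multiset.mem_toFinset]
      exact ⟨q, (Polynomial.mem_roots hrefl).2 hq, b, (Polynomial.mem_roots hquad).2 hb, rfl⟩
    have hT : T.card ≤ 6 * 2 := by
      refine (Finset.card_biUnion_le_card_mul _ _ 2 fun q _ => ?_).trans
        (Nat.mul_le_mul_right 2 ?_)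
      · exact Finset.card_image_le.trans ((Multiset.toFinset_card_le _).trans
          ((Polynomial.card_roots' _).trans (lineQuadratic_natDegree F q).le))
      · exact (Multiset.toFinset_card_le _).trans
          ((Polynomial.card_roots' _).trans (reflect_phiPoly_natDegree_le F))
    refine ⟨T.finite_toSet.subset hST, (Set.ncard_le_ncard hST T.finite_toSet).trans ?_⟩
    rwa [Set.ncard_coe_finset]
  refine ⟨hfin, fun h => ?_⟩
  have hphi : phiPoly K F = 0 := by
    by_contra hne
    obtain ⟨hf, hc⟩ := hfin hne
    rcases h with h | h
    exacts [h hf, absurd hc h.not_ge]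
  exact ⟨hphi, exists_residualCubic_singular hhom hline h1 h2 h3 h4 h5 h6 h7 h8 hphi⟩
end

section
/- Let K be an algebraically closed field of arbitrary characteristic, F ∈ K[x₀,x₁,x₂,x₃] an irreducible homogeneous polynomial of degree 4, and X = {F = 0} ⊂ ℙ³. Suppose ℓ₁, ℓ₂, ℓ₃ are three pairwise distinct lines lying on X such that every pair among them has nonempty intersection and every point lying on two of the three lines is a smooth point of X (the lines form a triangle in the line graph of X). Then ℓ₁, ℓ₂, ℓ₃ are contained in a common plane Π ⊂ ℙ³, and the restriction of F to Π is a product of four linear forms; i.e., X ∩ Π is a union of at most four lines (a completely reducible plane). -/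
open MvPolynomial

namespace MvPolynomial

variable {σ K : Type*} [Field K]

/-- The coefficients of `F` restricted to the parametrized line `t ↦ v + t w`. -/
noncomputable def alongLine (F : MvPolynomial σ K) (v w : σ → K) : Polynomial K :=
  aeval (fun i => Polynomial.C (v i) + Polynomial.X * Polynomial.C (w i)) F

theorem eval_alongLine (F : MvPolynomial σ K) (v w : σ → K) (t : K) :
    (F.alongLine v w).eval t = eval (v + t • w) F := by
  induction F using MvPolynomial.induction_on with
  | C a => simp [alongLine]
  | add p q hp hq => simpa [alongLine] using congrArg₂ (· + ·) hp hq
  | mul_X p i hp =>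
    simp only [alongLine, map_mul, aeval_X, Polynomial.eval_mul, eval_X] at hp ⊢
    rw [hp]
    simp [mul_comm (w i)]

theorem eval_derivative_alongLine [Fintype σ] (F : MvPolynomial σ K) (v w : σ → K) :
    (F.alongLine v w).derivative.eval 0 = ∑ i, eval v (pderiv i F) * w i := by
  classical
  induction F using MvPolynomial.induction_on with
  | C a => simp [alongLine]
  | add p q hp hq =>
    simp only [alongLine, map_add, Polynomial.eval_add, add_mul, Finset.sum_add_distrib] at *
    rw [hp, hq]
  | mul_X p i hp =>
    have h := eval_alongLine p v w 0
    simp only [alongLine, map_mul, aeval_X, Polynomial.derivative_mul, Polynomial.eval_add,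
      Polynomial.eval_mul, Derivation.leibniz, smul_eq_mul, map_add, add_mul,
      Finset.sum_add_distrib, pderiv_X] at *
    rw [hp, h]
    simp [Pi.single_apply, Finset.mul_sum, apply_ite, add_comm, mul_left_comm, mul_comm]

/-- The linear form `l` as a polynomial. -/
noncomputable def ofLinearForm [Fintype σ] [DecidableEq σ] (l : (σ → K) →ₗ[K] K) :
    MvPolynomial σ K :=
  ∑ i, C (l (Pi.single i 1)) * X i

/-- The cofactor of a homogeneous polynomial in a homogeneous polynomial
can be taken homogeneous. -/
theorem IsHomogeneous.exists_eq_mul {A Q : MvPolynomial σ K} {m n : ℕ}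
    (hA : A.IsHomogeneous m) (h : (A * Q).IsHomogeneous (m + n)) :
    ∃ R : MvPolynomial σ K, R.IsHomogeneous n ∧ A * Q = A * R := by
  let : GradedAlgebra (homogeneousSubmodule σ K) := gradedAlgebra
  refine ⟨_, (DirectSum.decompose (homogeneousSubmodule σ K) Q n).2, ?_⟩
  rw [← DirectSum.coe_decompose_mul_add_of_left_mem (homogeneousSubmodule σ K) (i := m) hA,
    DirectSum.decompose_of_mem_same (homogeneousSubmodule σ K) h]

theorem IsHomogeneous.exists_linearMap {F : MvPolynomial σ K} (hF : F.IsHomogeneous 1) :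
    ∃ l : (σ → K) →ₗ[K] K, ∀ v, eval v F = l v := by
  replace hF : F ∈ Submodule.span K (Set.range (X : σ → MvPolynomial σ K)) := by
    rw [← homogeneousSubmodule_one_eq_span_X]
    exact hF
  induction hF using Submodule.span_induction with
  | mem p hp =>
    obtain ⟨i, rfl⟩ := hp
    exact ⟨LinearMap.proj i, by simp⟩
  | zero => exact ⟨0, by simp⟩
  | add p q _ _ hp hq =>
    obtain ⟨l, hl⟩ := hp
    obtain ⟨m, hm⟩ := hq
    exact ⟨l + m, by simp [hl, hm]⟩
  | smul a p _ hp =>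
    obtain ⟨l, hl⟩ := hp
    exact ⟨a • l, by simp [hl, smul_eval]⟩

section

variable [Fintype σ] [DecidableEq σ]

theorem isHomogeneous_ofLinearForm (l : (σ → K) →ₗ[K] K) : (ofLinearForm l).IsHomogeneous 1 :=
  IsHomogeneous.sum _ _ _ fun i _ => isHomogeneous_C_mul_X _ i

theorem eval_ofLinearForm (l : (σ → K) →ₗ[K] K) (v : σ → K) :
    eval v (ofLinearForm l) = l v := by
  rw [LinearMap.pi_apply_eq_sum_univ l v]
  have h (i : σ) : (fun j => if i = j then (1 : K) else 0) = Pi.single i 1 := by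
    ext j
    simp [Pi.single_apply, eq_comm]
  simp [ofLinearForm, mul_comm, h]

/-- A polynomial vanishing on a hyperplane is divisible by the form defining it. -/
theorem ofLinearForm_dvd [Infinite K] {l : (σ → K) →ₗ[K] K} (hl : l ≠ 0)
    {F : MvPolynomial σ K} (hF : ∀ v, l v = 0 → eval v F = 0) : ofLinearForm l ∣ F := by
  obtain ⟨u, hu⟩ : ∃ u, l u = 1 := by
    obtain ⟨u, hu⟩ : ∃ u, l u ≠ 0 := by
      by_contra! h
      exact hl (LinearMap.ext h)
    exact ⟨(l u)⁻¹ • u, by simp [hu]⟩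
  let s : MvPolynomial σ K →ₐ[K] MvPolynomial σ K :=
    aeval fun i => X i - C (u i) * ofLinearForm l
  have hs (P : MvPolynomial σ K) (v : σ → K) : eval v (s P) = eval (v - l v • u) P := by
    induction P using MvPolynomial.induction_on with
    | C a => simp [s]
    | add p q hp hq => simp [hp, hq]
    | mul_X p i hp =>
      rw [map_mul, map_mul, hp]
      simp [s, eval_ofLinearForm, mul_comm]
  have hs0 : s F = 0 := MvPolynomial.funext fun v => by
    rw [hs, hF _ (by simp [hu]), map_zero]
  have hmod (P : MvPolynomial σ K) : ofLinearForm l ∣ P - s P := by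
    induction P using MvPolynomial.induction_on with
    | C a => simp [s]
    | add p q hp hq => simpa [add_sub_add_comm] using dvd_add hp hq
    | mul_X p i hp =>
      have : p * X i - s (p * X i) =
          (p - s p) * X i + ofLinearForm l * (C (u i) * s p) := by
        simp only [map_mul, s, aeval_X]
        ring
      rw [this]
      exact dvd_add (hp.mul_right _) (dvd_mul_right _ _)
  simpa [hs0] using hmod F

/-- A polynomial vanishing on a subspace still vanishes there after division by a linear form
that is nonzero on that subspace. -/
theorem eval_eq_zero_of_ofLinearForm_mul [Infinite K] {l : (σ → K) →ₗ[K] K}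
    {H : MvPolynomial σ K} {S : Submodule K (σ → K)} {u : σ → K} (hu : u ∈ S) (hlu : l u ≠ 0)
    (hS : ∀ v ∈ S, eval v (ofLinearForm l * H) = 0) : ∀ v ∈ S, eval v H = 0 := by
  intro v hv
  have hmul : (ofLinearForm l).alongLine v u * H.alongLine v u = 0 :=
    Polynomial.funext fun t => by
      have := hS (v + t • u) (S.add_mem hv (S.smul_mem t hu))
      simpa [eval_alongLine] using this
  have hne : (ofLinearForm l).alongLine v u ≠ 0 := by
    intro h
    have h0 := eval_alongLine (ofLinearForm l) v u 0
    have h1 := eval_alongLine (ofLinearForm l) v u 1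
    simp only [h, Polynomial.eval_zero, eval_ofLinearForm, zero_smul, add_zero, one_smul,
      map_add] at h0 h1
    exact hlu (by rw [← h0, zero_add] at h1; exact h1.symm)
  have := eval_alongLine H v u 0
  rw [(mul_eq_zero.mp hmul).resolve_left hne] at this
  simpa using this.symm

/-- A homogeneous quartic polynomial vanishing on three pairwise distinct hyperplanes
is a product of linear forms. -/
theorem IsHomogeneous.exists_eval_eq_mul_of_vanish_on_hyperplanes [Infinite K]
    {F : MvPolynomial σ K} (hF : F.IsHomogeneous 4) {l₁ l₂ l₃ : (σ → K) →ₗ[K] K}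
    (h₁ : ∀ v, l₁ v = 0 → eval v F = 0) (h₂ : ∀ v, l₂ v = 0 → eval v F = 0)
    (h₃ : ∀ v, l₃ v = 0 → eval v F = 0) (hl₃ : l₃ ≠ 0)
    (h₁₂ : ∃ u, l₂ u = 0 ∧ l₁ u ≠ 0) (h₁₃ : ∃ u, l₃ u = 0 ∧ l₁ u ≠ 0)
    (h₂₃ : ∃ u, l₃ u = 0 ∧ l₂ u ≠ 0) :
    ∃ l₄ : (σ → K) →ₗ[K] K, ∀ v, eval v F = l₁ v * l₂ v * l₃ v * l₄ v := by
  obtain ⟨u₁₂, hu₁₂, hu₁₂'⟩ := h₁₂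
  obtain ⟨u₁₃, hu₁₃, hu₁₃'⟩ := h₁₃
  obtain ⟨u₂₃, hu₂₃, hu₂₃'⟩ := h₂₃
  obtain ⟨P, rfl⟩ := ofLinearForm_dvd (fun h => hu₁₂' (by simp [h])) h₁
  obtain ⟨Q, rfl⟩ := ofLinearForm_dvd (l := l₂) (fun h => hu₂₃' (by simp [h]))
    (eval_eq_zero_of_ofLinearForm_mul (S := LinearMap.ker l₂) hu₁₂ hu₁₂' h₂)
  obtain ⟨R, rfl⟩ := ofLinearForm_dvd hl₃
    (eval_eq_zero_of_ofLinearForm_mul (S := LinearMap.ker l₃) hu₂₃ hu₂₃'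
      (eval_eq_zero_of_ofLinearForm_mul (S := LinearMap.ker l₃) hu₁₃ hu₁₃' h₃))
  rw [← mul_assoc, ← mul_assoc] at hF ⊢
  obtain ⟨S, hS, hRS⟩ := (((isHomogeneous_ofLinearForm l₁).mul (isHomogeneous_ofLinearForm l₂)).mul
    (isHomogeneous_ofLinearForm l₃)).exists_eq_mul (n := 1) hF
  obtain ⟨l₄, hl₄⟩ := hS.exists_linearMap
  exact ⟨l₄, fun v => by simp [hRS, eval_ofLinearForm, hl₄]⟩

/-- The pullback of `F` along a linear endomorphism. -/
noncomputable def compLinear (F : MvPolynomial σ K) (f : (σ → K) →ₗ[K] (σ → K)) :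
    MvPolynomial σ K :=
  aeval (fun i => ofLinearForm (LinearMap.proj i ∘ₗ f)) F

theorem eval_compLinear (F : MvPolynomial σ K) (f : (σ → K) →ₗ[K] (σ → K)) (v : σ → K) :
    eval v (F.compLinear f) = eval (f v) F := by
  induction F using MvPolynomial.induction_on with
  | C a => simp [compLinear]
  | add p q hp hq => simpa [compLinear] using congrArg₂ (· + ·) hp hq
  | mul_X p i hp =>
    simp only [compLinear, map_mul, aeval_X, eval_X, eval_ofLinearForm] at hp ⊢
    rw [hp, LinearMap.comp_apply, LinearMap.proj_apply]

theorem IsHomogeneous.compLinear {F : MvPolynomial σ K} {n : ℕ} (hF : F.IsHomogeneous n)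
    (f : (σ → K) →ₗ[K] (σ → K)) : (F.compLinear f).IsHomogeneous n := by
  have h := hF.aeval (n := 1) (fun i => ofLinearForm (LinearMap.proj i ∘ₗ f))
    fun i => isHomogeneous_ofLinearForm _
  rwa [one_mul] at h

end

/-- If `F` vanishes on a subspace, then the subspace is contained in the tangent space to `F`
at each of its points. -/
theorem sum_pderiv_mul_eq_zero [Fintype σ] [Infinite K] {F : MvPolynomial σ K}
    {W : Submodule K (σ → K)} (hW : ∀ v ∈ W, eval v F = 0) {v w : σ → K} (hv : v ∈ W)
    (hw : w ∈ W) : ∑ i, eval v (pderiv i F) * w i = 0 := by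
  have h0 : F.alongLine v w = 0 := Polynomial.funext fun t => by
    rw [eval_alongLine, hW _ (W.add_mem hv (W.smul_mem t hw)), Polynomial.eval_zero]
  rw [← eval_derivative_alongLine, h0]
  simp

end MvPolynomial

section

open Module

variable {K V : Type*} [Field K] [AddCommGroup V] [Module K V] [FiniteDimensional K V]

/-- A subspace of codimension one in `P` is cut out on `P` by a linear form. -/
theorem Submodule.exists_dual_cutting {W P : Submodule K V} (hWP : W ≤ P)
    (h : finrank K P = finrank K W + 1) :
    ∃ l : V →ₗ[K] K, ∀ v ∈ P, l v = 0 ↔ v ∈ W := by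
  obtain ⟨u, huP, huW⟩ : ∃ u ∈ P, u ∉ W := by
    by_contra! hle
    have := Submodule.finrank_mono (show P ≤ W from hle)
    omega
  obtain ⟨f, hfu, hf⟩ := Submodule.exists_le_ker_of_notMem huW
  have hlt : P ⊓ LinearMap.ker f < P :=
    lt_of_le_of_ne inf_le_left fun e => hfu (inf_eq_left.mp e huP)
  have hcard := Submodule.finrank_lt_finrank_of_lt hlt
  have heq : W = P ⊓ LinearMap.ker f :=
    Submodule.eq_of_le_of_finrank_le (le_inf hWP hf) (by omega)
  refine ⟨f, fun v hv => ⟨fun h0 => ?_, fun hv => hf hv⟩⟩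
  rw [heq]
  exact ⟨hv, h0⟩

theorem Submodule.exists_mem_notMem_of_finrank_eq {W W' : Submodule K V}
    (h : finrank K W = finrank K W') (hne : W ≠ W') : ∃ u ∈ W', u ∉ W := by
  by_contra! hle
  exact hne (Submodule.eq_of_le_of_finrank_eq hle h.symm).symm

/-- Two distinct lines through a common point span a plane. -/
theorem Submodule.finrank_sup_eq_three {W W' : Submodule K V} (hW : finrank K W = 2)
    (hW' : finrank K W' = 2) (hne : W ≠ W') (hmeet : W ⊓ W' ≠ ⊥) :
    finrank K (W ⊔ W' : Submodule K V) = 3 := by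
  have hsum := Submodule.finrank_sup_add_finrank_inf_eq W W'
  have hpos := Submodule.one_le_finrank_iff.mpr hmeet
  obtain ⟨u, hu, hu'⟩ := Submodule.exists_mem_notMem_of_finrank_eq (hW.trans hW'.symm) hne
  have hlt : W ⊓ W' < W' := lt_of_le_of_ne inf_le_right fun e => hu' (inf_eq_right.mp e hu)
  have := Submodule.finrank_lt_finrank_of_lt hlt
  omega

/-- Three pairwise meeting, non-concurrent lines are coplanar. -/
theorem Submodule.le_sup_of_pairwise_meet {W₁ W₂ W₃ : Submodule K V}
    (hW₃ : finrank K W₃ = 2) (h₁₃ : W₁ ⊓ W₃ ≠ ⊥) (h₂₃ : W₂ ⊓ W₃ ≠ ⊥)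
    (h : W₁ ⊓ W₂ ⊓ W₃ = ⊥) : W₃ ≤ W₁ ⊔ W₂ := by
  have hsum := Submodule.finrank_sup_add_finrank_inf_eq (W₁ ⊓ W₃) (W₂ ⊓ W₃)
  have hinf : W₁ ⊓ W₃ ⊓ (W₂ ⊓ W₃) = ⊥ := by rw [← inf_inf_distrib_right, h]
  have h1 := Submodule.one_le_finrank_iff.mpr h₁₃
  have h2 := Submodule.one_le_finrank_iff.mpr h₂₃
  rw [hinf, finrank_bot] at hsum
  have heq : W₁ ⊓ W₃ ⊔ W₂ ⊓ W₃ = W₃ :=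
    Submodule.eq_of_le_of_finrank_le (sup_le inf_le_right inf_le_right) (by omega)
  rw [← heq]
  exact sup_le_sup inf_le_left inf_le_left

end

/-- A quartic form vanishing on three distinct lines of a plane restricts to that plane as a
product of linear forms. -/
theorem MvPolynomial.IsHomogeneous.exists_eq_mul_on_plane {σ K : Type*} [Fintype σ] [Field K]
    [Infinite K] {F : MvPolynomial σ K} (hF : F.IsHomogeneous 4)
    {P W₁ W₂ W₃ : Submodule K (σ → K)} (hP : Module.finrank K P = 3)
    (hW₁ : Module.finrank K W₁ = 2) (hW₂ : Module.finrank K W₂ = 2)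
    (hW₃ : Module.finrank K W₃ = 2)
    (hle₁ : W₁ ≤ P) (hle₂ : W₂ ≤ P) (hle₃ : W₃ ≤ P)
    (hon₁ : ∀ v ∈ W₁, eval v F = 0) (hon₂ : ∀ v ∈ W₂, eval v F = 0)
    (hon₃ : ∀ v ∈ W₃, eval v F = 0)
    (hne₁₂ : W₁ ≠ W₂) (hne₁₃ : W₁ ≠ W₃) (hne₂₃ : W₂ ≠ W₃) :
    ∃ l₁ l₂ l₃ l₄ : (σ → K) →ₗ[K] K, ∀ v ∈ P, eval v F = l₁ v * l₂ v * l₃ v * l₄ v := by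
  classical
  obtain ⟨g, hg⟩ := LinearMap.exists_leftInverse_of_injective P.subtype (by simp)
  let r : (σ → K) →ₗ[K] (σ → K) := P.subtype ∘ₗ g
  have hrP (v : σ → K) : r v ∈ P := (g v).2
  have hr (v : σ → K) (hv : v ∈ P) : r v = v :=
    congrArg Subtype.val (LinearMap.congr_fun hg ⟨v, hv⟩)
  obtain ⟨f₁, hf₁⟩ := Submodule.exists_dual_cutting hle₁ (by omega)
  obtain ⟨f₂, hf₂⟩ := Submodule.exists_dual_cutting hle₂ (by omega)
  obtain ⟨f₃, hf₃⟩ := Submodule.exists_dual_cutting hle₃ (by omega)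
  have hvanish {W : Submodule K (σ → K)} {f : (σ → K) →ₗ[K] K}
      (hf : ∀ v ∈ P, f v = 0 ↔ v ∈ W) (hon : ∀ v ∈ W, eval v F = 0) (v : σ → K)
      (hv : (f ∘ₗ r) v = 0) : eval v (F.compLinear r) = 0 := by
    rw [eval_compLinear]
    exact hon _ ((hf _ (hrP v)).mp hv)
  have hsep {W W' : Submodule K (σ → K)} {f f' : (σ → K) →ₗ[K] K}
      (hf : ∀ v ∈ P, f v = 0 ↔ v ∈ W) (hf' : ∀ v ∈ P, f' v = 0 ↔ v ∈ W') (hle : W' ≤ P)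
      (h : Module.finrank K W = Module.finrank K W') (hne : W ≠ W') :
      ∃ u, (f' ∘ₗ r) u = 0 ∧ (f ∘ₗ r) u ≠ 0 := by
    obtain ⟨u, hu, hu'⟩ := Submodule.exists_mem_notMem_of_finrank_eq h hne
    refine ⟨u, ?_, ?_⟩
    · rw [LinearMap.comp_apply, hr u (hle hu), hf' u (hle hu)]
      exact hu
    · rw [LinearMap.comp_apply, hr u (hle hu), ne_eq, hf u (hle hu)]
      exact hu'
  have hne₃ : f₃ ∘ₗ r ≠ 0 := by
    obtain ⟨u, -, hu⟩ := hsep hf₃ hf₁ hle₁ (hW₃.trans hW₁.symm) hne₁₃.symm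
    exact fun h => hu (by simp [h])
  obtain ⟨l₄, hl₄⟩ := (hF.compLinear r).exists_eval_eq_mul_of_vanish_on_hyperplanes
    (hvanish hf₁ hon₁) (hvanish hf₂ hon₂) (hvanish hf₃ hon₃) hne₃
    (hsep hf₁ hf₂ hle₂ (hW₁.trans hW₂.symm) hne₁₂)
    (hsep hf₁ hf₃ hle₃ (hW₁.trans hW₃.symm) hne₁₃)
    (hsep hf₂ hf₃ hle₃ (hW₂.trans hW₃.symm) hne₂₃)
  refine ⟨f₁ ∘ₗ r, f₂ ∘ₗ r, f₃ ∘ₗ r, l₄, fun v hv => ?_⟩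
  rw [← hl₄, eval_compLinear, hr v hv]

/-- Over an algebraically closed field, if three pairwise distinct
lines on an irreducible quartic surface `X = {F = 0}` pairwise meet and all their
pairwise intersection points are smooth points of `X` (a triangle), then the three
lines lie in a common plane `Π` and the restriction of `F` to `Π` is a product of
four linear forms (a completely reducible plane).  Lines are 2-dimensional subspaces,
planes are 3-dimensional subspaces of `K⁴`; two lines meet iff the corresponding
subspaces intersect nontrivially. -/
theorem triangle_gives_completely_reducible_plane
    (K : Type*) [Field K] [IsAlgClosed K]
    (F : MvPolynomial (Fin 4) K) (hirr : Irreducible F) (hhom : F.IsHomogeneous 4)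
    (W₁ W₂ W₃ : Submodule K (Fin 4 → K))
    (hW₁ : Module.finrank K W₁ = 2) (hW₂ : Module.finrank K W₂ = 2)
    (hW₃ : Module.finrank K W₃ = 2)
    (hon₁ : ∀ v ∈ W₁, eval v F = 0) (hon₂ : ∀ v ∈ W₂, eval v F = 0)
    (hon₃ : ∀ v ∈ W₃, eval v F = 0)
    (hne₁₂ : W₁ ≠ W₂) (hne₁₃ : W₁ ≠ W₃) (hne₂₃ : W₂ ≠ W₃)
    (hmeet₁₂ : W₁ ⊓ W₂ ≠ ⊥) (hmeet₁₃ : W₁ ⊓ W₃ ≠ ⊥) (hmeet₂₃ : W₂ ⊓ W₃ ≠ ⊥)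
    (hsmooth₁₂ : ∀ v : Fin 4 → K, v ≠ 0 → v ∈ W₁ ⊓ W₂ →
      ∃ i : Fin 4, eval v (pderiv i F) ≠ 0)
    (hsmooth₁₃ : ∀ v : Fin 4 → K, v ≠ 0 → v ∈ W₁ ⊓ W₃ →
      ∃ i : Fin 4, eval v (pderiv i F) ≠ 0)
    (hsmooth₂₃ : ∀ v : Fin 4 → K, v ≠ 0 → v ∈ W₂ ⊓ W₃ →
      ∃ i : Fin 4, eval v (pderiv i F) ≠ 0) :
    ∃ Pl : Submodule K (Fin 4 → K), Module.finrank K Pl = 3 ∧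
      W₁ ≤ Pl ∧ W₂ ≤ Pl ∧ W₃ ≤ Pl ∧
      ∃ l₁ l₂ l₃ l₄ : (Fin 4 → K) →ₗ[K] K,
        ∀ v ∈ Pl, eval v F = l₁ v * l₂ v * l₃ v * l₄ v := by
  have : Infinite K := IsAlgClosed.instInfinite
  suffices ∃ P : Submodule K (Fin 4 → K), Module.finrank K P = 3 ∧ W₁ ≤ P ∧ W₂ ≤ P ∧ W₃ ≤ P by
    obtain ⟨P, hP, h₁, h₂, h₃⟩ := this
    exact ⟨P, hP, h₁, h₂, h₃, hhom.exists_eq_mul_on_plane hP hW₁ hW₂ hW₃ h₁ h₂ h₃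
      hon₁ hon₂ hon₃ hne₁₂ hne₁₃ hne₂₃⟩
  by_cases hconc : W₁ ⊓ W₂ ⊓ W₃ = ⊥
  · exact ⟨W₁ ⊔ W₂, Submodule.finrank_sup_eq_three hW₁ hW₂ hne₁₂ hmeet₁₂, le_sup_left,
      le_sup_right, Submodule.le_sup_of_pairwise_meet hW₃ hmeet₁₃ hmeet₂₃ hconc⟩
  · obtain ⟨v, ⟨⟨hv₁, hv₂⟩, hv₃⟩, hv0⟩ := Submodule.exists_mem_ne_zero_of_ne_bot hconc
    obtain ⟨j, hj⟩ := hsmooth₁₂ v hv0 ⟨hv₁, hv₂⟩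
    let t : (Fin 4 → K) →ₗ[K] K := ∑ i, eval v (pderiv i F) • LinearMap.proj i
    have ht (w : Fin 4 → K) : t w = ∑ i, eval v (pderiv i F) * w i := by simp [t]
    have ht0 : t ≠ 0 := fun h => hj <| by
      have := ht (Pi.single j 1)
      simpa [h, Pi.single_apply] using this.symm
    refine ⟨LinearMap.ker t, ?_, fun w hw => ?_, fun w hw => ?_, fun w hw => ?_⟩
    · have := Module.Dual.finrank_ker_add_one_of_ne_zero (f := t) ht0
      rw [Module.finrank_fin_fun] at this
      omega
    · exact (ht w).trans (sum_pderiv_mul_eq_zero hon₁ hv₁ hw)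
    · exact (ht w).trans (sum_pderiv_mul_eq_zero hon₂ hv₂ hw)
    · exact (ht w).trans (sum_pderiv_mul_eq_zero hon₃ hv₃ hw)
end
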